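/- arXiv:1901.07231 — 5 statements merged into one kernel-verified Lean document; each statement's English description precedes it below -/
import Mathlib

section
/- Assume that any two distinct basic feasible solutions of Af = b have distinct cost, and let x* be the unique optimal solution of the weighted basis pursuit problem. Let a : [m] × ℝ → ℝ be differentiable reactivities depending only on the edge and on time (not on the state), with ε ≤ a_e(t) ≤ C for constants 0 < ε ≤ C and (d/dt)a_e(t) ≥ 0 for all e and t. Let x : [0,∞) → ℝ^m be the solution of ẋ_e(t) = a_e(t)·(|q_e(x(t))| − x_e(t)) with x(0) > 0. Then x(t) → x* and |q(x(t))| → x* as t → ∞. In particular this holds when each a_e is a positive constant. -/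
open Matrix Filter Set

/-- Energy of `f` with respect to costs `c` and (positive) capacities `x`:
`E_x(f) = ∑_e (c_e/x_e) f_e²`. -/
noncomputable def energy {m : ℕ} (c x f : Fin m → ℝ) : ℝ :=
  ∑ e, c e / x e * f e ^ 2

/-- Energy restricted to the support of `x` (for `x ≥ 0` possibly with zeros):
`∑_{e : x_e ≠ 0} (c_e/x_e) f_e²`. -/
noncomputable def energyS {m : ℕ} (c x f : Fin m → ℝ) : ℝ :=
  ∑ e, if x e = 0 then 0 else c e / x e * f e ^ 2

/-- Cost of a vector: `cᵀ|f| = ∑_e c_e |f_e|`. -/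
noncomputable def costVec {m : ℕ} (c f : Fin m → ℝ) : ℝ := ∑ e, c e * |f e|

/-- `f'` is sign-compatible with `f`: `f'_e ≠ 0` implies `f'_e f_e > 0`. -/
def SignCompat {m : ℕ} (f' f : Fin m → ℝ) : Prop :=
  ∀ e, f' e ≠ 0 → 0 < f' e * f e

/-- `f` is a basic feasible solution of `A f = b`: there is an injective choice `B`
of `n` columns such that `A_B` is invertible, `f_B = A_B⁻¹ b`, and `f` vanishes
outside `B`. -/
noncomputable def IsBFS {n m : ℕ} (A : Matrix (Fin n) (Fin m) ℝ) (b : Fin n → ℝ)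
    (f : Fin m → ℝ) : Prop :=
  A.mulVec f = b ∧ ∃ B : Fin n → Fin m, Function.Injective B ∧
    IsUnit (A.submatrix id B).det ∧
    (∀ i, f (B i) = (A.submatrix id B)⁻¹.mulVec b i) ∧
    ∀ e, (∀ i, B i ≠ e) → f e = 0

/-- The set of absolute values of determinants of square submatrices of `A`. -/
def subdetSet {n m : ℕ} (A : Matrix (Fin n) (Fin m) ℝ) : Set ℝ :=
  {d | ∃ (k : ℕ) (r : Fin k → Fin n) (s : Fin k → Fin m),
    Function.Injective r ∧ Function.Injective s ∧ d = |(A.submatrix r s).det|}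


lemma phys_bfs_of_li {n m : ℕ} (A : Matrix (Fin n) (Fin m) ℝ) (b : Fin n → ℝ)
    (hrank : A.rank = n) (f : Fin m → ℝ) (hf : A.mulVec f = b)
    (hli : ∀ h : Fin m → ℝ, A.mulVec h = 0 → (∀ e, f e = 0 → h e = 0) → h = 0) :
    IsBFS A b f := by
  have h1 : LinearIndepOn ℝ A.col {e | f e ≠ 0} := by
    rw [linearIndepOn_iff]
    intro l hl h0
    have h2 : A.mulVec l = 0 := by
      rw [Finsupp.linearCombination_apply, Finsupp.sum_fintype _ _ (by simp)] at h0
      rw [← h0]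
      ext i
      simp [Matrix.mulVec, dotProduct, Matrix.col_apply, mul_comm]
    have := hli l h2 (fun e he => by
      by_contra hne
      have : e ∈ (l.support : Set (Fin m)) := by simpa using hne
      exact hl this he)
    exact DFunLike.coe_injective (by simpa using this)
  obtain ⟨B, -, hsB, hspan, hB⟩ := exists_linearIndepOn_extension h1 (subset_univ _)
  have htop : Submodule.span ℝ (A.col '' B) = ⊤ := by
    have h3 : Submodule.span ℝ (Set.range A.col) = ⊤ := by
      apply Submodule.eq_top_of_finrank_eq
      rw [← Matrix.rank_eq_finrank_span_cols, hrank]; simp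
    rw [image_univ] at hspan
    rw [eq_top_iff, ← h3]
    exact Submodule.span_le.2 hspan
  have : Fintype B := Fintype.ofFinite _
  have hcard : Fintype.card B = n := by
    have h4 := finrank_span_eq_card (R := ℝ) hB
    have h5 : Set.range (fun x : B => A.col x) = A.col '' B := by
      ext; simp
    rw [h5, htop, finrank_top] at h4
    simpa using h4.symm
  let σ : Fin n ≃ B := (Fintype.equivFinOfCardEq hcard).symm
  have hinj : Function.Injective (fun i => (σ i : Fin m)) :=
    Subtype.val_injective.comp σ.injective
  have hunit : IsUnit (A.submatrix id (fun i => (σ i : Fin m))) := by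
    rw [← Matrix.linearIndependent_cols_iff_isUnit]
    exact LinearIndependent.comp hB σ σ.injective
  have hdet := (Matrix.isUnit_iff_isUnit_det _).1 hunit
  have hz : ∀ e, (∀ i, (σ i : Fin m) ≠ e) → f e = 0 := by
    intro e he
    by_contra hne
    have : e ∈ B := hsB hne
    exact he (σ.symm ⟨e, this⟩) (by simp)
  refine ⟨hf, fun i => σ i, hinj, hdet, ?_, hz⟩
  have hAB : (A.submatrix id (fun i => (σ i : Fin m))).mulVec (fun i => f (σ i)) = b := by
    rw [← hf]
    ext i
    simp only [Matrix.mulVec, dotProduct, Matrix.submatrix_apply, id]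
    rw [← Finset.sum_image (s := Finset.univ) (g := fun i => (σ i : Fin m))
      (f := fun e => A i e * f e) (fun x _ y _ h => hinj h)]
    apply Finset.sum_subset (Finset.subset_univ _)
    intro e _ he
    rw [hz e (fun i hi => he (by simp [← hi])), mul_zero]
  intro i
  rw [← hAB, Matrix.mulVec_mulVec, Matrix.nonsing_inv_mul _ hdet, Matrix.one_mulVec]

lemma phys_cost_continuous {m : ℕ} (c : Fin m → ℝ) : Continuous (costVec c) := by
  unfold costVec; fun_prop

lemma phys_compact {n m : ℕ} (A : Matrix (Fin n) (Fin m) ℝ) (b : Fin n → ℝ)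
    (c : Fin m → ℝ) (hc1 : ∀ e, 1 ≤ c e) (K : ℝ) :
    IsCompact {f : Fin m → ℝ | A.mulVec f = b ∧ costVec c f ≤ K} := by
  have hcl : IsClosed {f : Fin m → ℝ | A.mulVec f = b ∧ costVec c f ≤ K} := by
    apply IsClosed.inter
    · exact isClosed_eq (by fun_prop) continuous_const
    · exact isClosed_le (phys_cost_continuous c) continuous_const
  refine IsCompact.of_isClosed_subset (isCompact_univ_pi (fun _ : Fin m => isCompact_Icc (a := -K) (b := K))) hcl ?_
  rintro f ⟨-, hf⟩ e -
  have : c e * |f e| ≤ costVec c f :=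
    Finset.single_le_sum (f := fun e => c e * |f e|)
      (fun i _ => mul_nonneg (by linarith [hc1 i]) (abs_nonneg _)) (Finset.mem_univ e)
  have h2 : |f e| ≤ c e * |f e| := le_mul_of_one_le_left (abs_nonneg _) (hc1 e)
  exact abs_le.1 (by linarith)

lemma phys_unique {n m : ℕ} (A : Matrix (Fin n) (Fin m) ℝ) (b : Fin n → ℝ) (c : Fin m → ℝ)
    (hc1 : ∀ e, 1 ≤ c e) (hrank : A.rank = n)
    (hdistinct : ∀ f g : Fin m → ℝ, IsBFS A b f → IsBFS A b g → f ≠ g →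
      costVec c f ≠ costVec c g) (f0 : Fin m → ℝ) (hf0 : A.mulVec f0 = b)
    (hmin : ∀ f, A.mulVec f = b → costVec c f0 ≤ costVec c f)
    (g : Fin m → ℝ) (hg : A.mulVec g = b) (hgc : costVec c g ≤ costVec c f0) : g = f0 := by
  set S := {f : Fin m → ℝ | A.mulVec f = b ∧ costVec c f ≤ costVec c f0} with hS
  have hcomp : IsCompact S := phys_compact A b c hc1 _
  have hconv : Convex ℝ S := by
    rintro x ⟨hx, hxc⟩ y ⟨hy, hyc⟩ s t hs ht hst
    refine ⟨?_, ?_⟩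
    · rw [Matrix.mulVec_add, Matrix.mulVec_smul, Matrix.mulVec_smul, hx, hy, ← add_smul, hst,
        one_smul]
    · have : costVec c (s • x + t • y) ≤ s * costVec c x + t * costVec c y := by
        unfold costVec
        rw [Finset.mul_sum, Finset.mul_sum, ← Finset.sum_add_distrib]
        apply Finset.sum_le_sum
        intro e _
        have h1 : |(s • x + t • y) e| ≤ s * |x e| + t * |y e| := by
          simp only [Pi.add_apply, Pi.smul_apply, smul_eq_mul]
          refine (abs_add_le _ _).trans ?_
          rw [abs_mul, abs_mul, abs_of_nonneg hs, abs_of_nonneg ht]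
        have := mul_le_mul_of_nonneg_left h1 (show 0 ≤ c e by linarith [hc1 e])
        linarith
      have h1 := mul_le_mul_of_nonneg_left hxc hs
      have h2 := mul_le_mul_of_nonneg_left hyc ht
      have h3 : s * costVec c f0 + t * costVec c f0 = costVec c f0 := by
        rw [← add_mul, hst, one_mul]
      linarith
  have hbfs : ∀ f ∈ S.extremePoints ℝ, IsBFS A b f := by
    intro f hf
    have hfS : f ∈ S := hf.1
    apply phys_bfs_of_li A b hrank f hfS.1
    intro h hh hsupp
    set s := ∑ e, |h e| / |f e| with hs
    have hs0 : 0 ≤ s := Finset.sum_nonneg (fun _ _ => by positivity)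
    set δ := (s + 1)⁻¹ with hδ
    have hδ0 : 0 < δ := by positivity
    have hsmall : ∀ e, |δ * h e| ≤ |f e| := by
      intro e
      by_cases hfe : f e = 0
      · rw [hsupp e hfe]; simp
      have hp : 0 < |f e| := abs_pos.2 hfe
      have h1 : |h e| / |f e| ≤ s :=
        Finset.single_le_sum (f := fun e => |h e| / |f e|) (fun _ _ => by positivity)
          (Finset.mem_univ e)
      rw [div_le_iff₀ hp] at h1
      rw [abs_mul, abs_of_pos hδ0, hδ, inv_mul_le_iff₀ (by positivity)]
      nlinarith
    have hsum : costVec c (f + δ • h) + costVec c (f - δ • h) = 2 * costVec c f := by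
      unfold costVec
      rw [← Finset.sum_add_distrib, Finset.mul_sum]
      apply Finset.sum_congr rfl
      intro e _
      have h1 : |f e + δ * h e| + |f e - δ * h e| = 2 * |f e| := by
        have h2 := hsmall e
        generalize δ * h e = y at *
        generalize f e = z at *
        rcases abs_cases z with h | h <;> rcases abs_cases y with h' | h' <;>
        rcases abs_cases (z + y) with h'' | h'' <;> rcases abs_cases (z - y) with h3 | h3 <;>
          linarith
      simp only [Pi.add_apply, Pi.sub_apply, Pi.smul_apply, smul_eq_mul]
      linear_combination c e * h1
    have hA1 : A.mulVec (f + δ • h) = b := by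
      rw [Matrix.mulVec_add, Matrix.mulVec_smul, hh, hfS.1]; simp
    have hA2 : A.mulVec (f - δ • h) = b := by
      rw [Matrix.mulVec_sub, Matrix.mulVec_smul, hh, hfS.1]; simp
    have hm1 := hmin _ hA1
    have hm2 := hmin _ hA2
    have hm3 := hfS.2
    have := (mem_extremePoints.1 hf).2 (f + δ • h) ⟨hA1, by linarith⟩ (f - δ • h)
      ⟨hA2, by linarith⟩ ⟨1/2, 1/2, by norm_num, by norm_num, by norm_num, by
        ext e; simp; ring⟩
    have h5 : δ • h = 0 := by simpa using this.1
    exact (smul_eq_zero.1 h5).resolve_left hδ0.ne'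
  have hKM := closure_convexHull_extremePoints hcomp hconv
  obtain ⟨p, hp⟩ := hcomp.extremePoints_nonempty ⟨f0, hf0, le_rfl⟩
  have hsing : S.extremePoints ℝ = {p} := by
    refine Set.eq_singleton_iff_unique_mem.2 ⟨hp, fun r hr => ?_⟩
    by_contra hne
    have h1 : r ∈ S := hr.1
    have h2 : p ∈ S := hp.1
    exact hdistinct r p (hbfs r hr) (hbfs p hp) hne
      (le_antisymm (h1.2.trans (hmin _ h2.1)) (h2.2.trans (hmin _ h1.1)))
  rw [hsing, convexHull_singleton, closure_singleton] at hKM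
  have h1 : g ∈ S := ⟨hg, hgc⟩
  have h2 : f0 ∈ S := ⟨hf0, le_rfl⟩
  rw [← hKM] at h1 h2
  rw [Set.mem_singleton_iff.1 h1, Set.mem_singleton_iff.1 h2]

lemma phys_orth {n m : ℕ} (A : Matrix (Fin n) (Fin m) ℝ) (b : Fin n → ℝ) (c x q : Fin m → ℝ)
    (hc1 : ∀ e, 1 ≤ c e) (hx : ∀ e, 0 < x e) (hq : A.mulVec q = b)
    (hmin : ∀ f : Fin m → ℝ, A.mulVec f = b → energy c x q ≤ energy c x f)
    (f : Fin m → ℝ) (hf : A.mulVec f = b) :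
    energy c x q ≤ ∑ e, c e / x e * (q e * f e) := by
  set P := ∑ e, c e / x e * (q e * (f e - q e)) with hP
  set Q := energy c x (f - q) with hQ
  have hPe : ∑ e, c e / x e * (q e * f e) = energy c x q + P := by
    rw [hP, energy, ← Finset.sum_add_distrib]
    exact Finset.sum_congr rfl (fun e _ => by ring)
  have hQ0 : 0 ≤ Q := Finset.sum_nonneg (fun e _ => by
    have := hx e; have := hc1 e; positivity)
  have key : ∀ δ : ℝ, 0 ≤ 2 * δ * P + δ ^ 2 * Q := by
    intro δ
    have h1 := hmin (q + δ • (f - q)) (by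
      rw [Matrix.mulVec_add, Matrix.mulVec_smul, Matrix.mulVec_sub, hq, hf]; simp)
    have h2 : energy c x (q + δ • (f - q)) = energy c x q + (2 * δ * P + δ ^ 2 * Q) := by
      rw [hP, hQ]; unfold energy
      rw [Finset.mul_sum, Finset.mul_sum, ← Finset.sum_add_distrib, ← Finset.sum_add_distrib]
      refine Finset.sum_congr rfl (fun e _ => ?_)
      simp only [Pi.add_apply, Pi.smul_apply, Pi.sub_apply, smul_eq_mul]; ring
    linarith
  rw [hPe]
  by_contra hcon
  have hneg : P < 0 := by linarith
  have h3 := key (-P / (Q + 1))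
  have h4 : 2 * (-P / (Q + 1)) * P + (-P / (Q + 1)) ^ 2 * Q
      = - (P ^ 2 * (Q + 2)) / (Q + 1) ^ 2 := by
    field_simp; ring
  rw [h4] at h3
  have hP2 : 0 < P ^ 2 := by nlinarith
  have h5 : 0 < (P ^ 2 * (Q + 2)) / (Q + 1) ^ 2 := by positivity
  rw [neg_div] at h3
  linarith

open Topology in
/-- Abstract envelope continuity: the minimal energy along a curve is continuous. -/
lemma phys_energy_cont {m : ℕ} (c : Fin m → ℝ) (hc1 : ∀ e, 1 ≤ c e)
    (x : ℝ → Fin m → ℝ) (p : ℝ → Fin m → ℝ)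
    (hpos : ∀ t ∈ Set.Ici (0 : ℝ), ∀ e, 0 < x t e)
    (hcont : ∀ e, ContinuousOn (fun t => x t e) (Set.Ici 0))
    (hmin : ∀ t ∈ Set.Ici (0 : ℝ), ∀ s, s ∈ Set.Ici (0 : ℝ) →
      energy c (x t) (p t) ≤ energy c (x t) (p s)) :
    ContinuousOn (fun t => energy c (x t) (p t)) (Set.Ici 0) := by
  intro t ht
  have hup : Tendsto (fun s => energy c (x s) (p t)) (𝓝[Set.Ici 0] t)
      (𝓝 (energy c (x t) (p t))) := by
    unfold energy
    refine tendsto_finsetSum _ (fun e _ => ?_)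
    exact ((tendsto_const_nhds.div (hcont e t ht) (hpos t ht e).ne').mul_const _)
  have hr : Tendsto (fun s => 1 + ∑ e, |x s e / x t e - 1|) (𝓝[Set.Ici 0] t) (𝓝 1) := by
    have : Tendsto (fun s => 1 + ∑ e, |x s e / x t e - 1|) (𝓝[Set.Ici 0] t)
        (𝓝 (1 + ∑ e : Fin m, |x t e / x t e - 1|)) := by
      refine tendsto_const_nhds.add (tendsto_finsetSum _ (fun e _ => ?_))
      exact (((hcont e t ht).tendsto.div_const _).sub_const _).abs
    simpa [div_self (hpos t ht _).ne'] using this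
  have hlo : Tendsto (fun s => energy c (x t) (p t) / (1 + ∑ e, |x s e / x t e - 1|))
      (𝓝[Set.Ici 0] t) (𝓝 (energy c (x t) (p t))) := by
    have h := (tendsto_const_nhds (x := energy c (x t) (p t))).div hr one_ne_zero
    rw [div_one] at h
    exact h
  refine tendsto_of_tendsto_of_tendsto_of_le_of_le' hlo hup ?_ ?_
  · filter_upwards [self_mem_nhdsWithin] with s hs
    have h0 : 0 ≤ ∑ e, |x s e / x t e - 1| := Finset.sum_nonneg (fun _ _ => abs_nonneg _)
    rw [div_le_iff₀ (by positivity)]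
    refine (hmin t ht s hs).trans ?_
    unfold energy
    rw [Finset.sum_mul]
    refine Finset.sum_le_sum (fun e _ => ?_)
    have h1 : x s e / x t e ≤ 1 + ∑ e, |x s e / x t e - 1| := by
      have := Finset.single_le_sum (f := fun e => |x s e / x t e - 1|)
        (fun _ _ => abs_nonneg _) (Finset.mem_univ e)
      have h2 := le_abs_self (x s e / x t e - 1)
      linarith
    have hs' := hpos s hs e
    have ht' := hpos t ht e
    have hce := hc1 e
    have h3 : c e / x t e * p s e ^ 2 = (c e / x s e * p s e ^ 2) * (x s e / x t e) := by
      field_simp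
    rw [h3]
    exact mul_le_mul_of_nonneg_left h1 (by positivity)
  · filter_upwards [self_mem_nhdsWithin] with s hs
    exact hmin s hs t ht

open Topology in
lemma phys_lyap {m : ℕ} (c : Fin m → ℝ) (hc1 : ∀ e, 1 ≤ c e)
    (x : ℝ → Fin m → ℝ) (p : ℝ → Fin m → ℝ) (a : Fin m → ℝ → ℝ)
    (ha : ∀ e t, 0 < a e t)
    (hpos : ∀ t ∈ Set.Ici (0 : ℝ), ∀ e, 0 < x t e)
    (hdyn : ∀ t ∈ Set.Ici (0 : ℝ), ∀ e, HasDerivWithinAt (fun s => x s e)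
      (a e t * (|p t e| - x t e)) (Set.Ici 0) t)
    (hmin : ∀ t ∈ Set.Ici (0 : ℝ), ∀ s, s ∈ Set.Ici (0 : ℝ) →
      energy c (x t) (p t) ≤ energy c (x t) (p s))
    (u v : ℝ) (hu : 0 ≤ u) (huv : u ≤ v) :
    energy c (x v) (p v) + ∑ e, c e * x v e ≤ energy c (x u) (p u) + ∑ e, c e * x u e := by
  have hcont : ∀ e, ContinuousOn (fun t => x t e) (Set.Ici 0) :=
    fun e t ht => (hdyn t ht e).continuousWithinAt
  have hc2 := phys_energy_cont c hc1 x p hpos hcont hmin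
  have hLc : ContinuousOn (fun t => energy c (x t) (p t) + ∑ e, c e * x t e) (Set.Ici 0) :=
    hc2.add (continuousOn_finsetSum _ (fun e _ => continuousOn_const.mul (hcont e)))
  have hsub : Icc u v ⊆ Set.Ici 0 := fun t ht => hu.trans ht.1
  refine image_le_of_liminf_slope_right_le_deriv_boundary
    (f := fun t => energy c (x t) (p t) + ∑ e, c e * x t e) (a := u) (b := v)
    (hLc.mono hsub) (B := fun _ => energy c (x u) (p u) + ∑ e, c e * x u e) (B' := fun _ => 0)
    le_rfl continuousOn_const (fun t _ => hasDerivWithinAt_const _ _ _) ?_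
    (right_mem_Icc.2 huv)
  intro t ht r hr
  have ht0 : t ∈ Set.Ici (0 : ℝ) := hsub (Ico_subset_Icc_self ht)
  have hFd : HasDerivWithinAt (fun s => energy c (x s) (p t) + ∑ e, c e * x s e)
      (∑ e, (-(c e * (a e t * (|p t e| - x t e))) / (x t e) ^ 2 * p t e ^ 2)
        + ∑ e, c e * (a e t * (|p t e| - x t e))) (Set.Ici 0) t := by
    unfold energy
    refine HasDerivWithinAt.add (HasDerivWithinAt.fun_sum fun e _ => ?_)
      (HasDerivWithinAt.fun_sum fun e _ => ?_)
    · have h1 := ((hasDerivWithinAt_const t (Set.Ici 0) (c e)).fun_div (hdyn t ht0 e)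
        (hpos t ht0 e).ne').mul_const (p t e ^ 2)
      refine h1.congr_deriv ?_
      ring
    · exact (hdyn t ht0 e).const_mul (c e)
  have hneg : ∑ e, (-(c e * (a e t * (|p t e| - x t e))) / (x t e) ^ 2 * p t e ^ 2)
        + ∑ e, c e * (a e t * (|p t e| - x t e)) ≤ 0 := by
    rw [← Finset.sum_add_distrib]
    refine Finset.sum_nonpos (fun e _ => ?_)
    have hx := hpos t ht0 e
    have hae := ha e t
    have hce := hc1 e
    have h1 : -(c e * (a e t * (|p t e| - x t e))) / (x t e) ^ 2 * p t e ^ 2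
        + c e * (a e t * (|p t e| - x t e))
        = - (c e * a e t * (|p t e| - x t e) ^ 2 * (|p t e| + x t e) / (x t e) ^ 2) := by
      rw [← sq_abs (p t e)]
      field_simp; ring
    rw [h1]
    have : 0 ≤ c e * a e t * (|p t e| - x t e) ^ 2 * (|p t e| + x t e) / (x t e) ^ 2 := by
      positivity
    linarith
  have hFd' := hFd.mono (show Set.Ioi t ⊆ Set.Ici 0 from fun s hs => le_trans (mem_Ici.1 ht0) (le_of_lt (mem_Ioi.1 hs)))
  rw [hasDerivWithinAt_iff_tendsto_slope' (by simp)] at hFd'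
  have hev := hFd'.eventually (gt_mem_nhds (hneg.trans_lt hr))
  refine Eventually.frequently ?_
  filter_upwards [hev, self_mem_nhdsWithin] with s hs hst
  refine lt_of_le_of_lt ?_ hs
  have hst' : t < s := hst
  have hs0 : s ∈ Set.Ici (0 : ℝ) := ht0.trans hst'.le
  rw [slope_def_field, slope_def_field]
  refine div_le_div_of_nonneg_right ?_ (by linarith)
  have := hmin s hs0 t ht0
  linarith

lemma phys_rate {m : ℕ} (c : Fin m → ℝ) (hc1 : ∀ e, 1 ≤ c e)
    (x : ℝ → Fin m → ℝ) (p : ℝ → Fin m → ℝ) (a : Fin m → ℝ → ℝ)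
    (ha : ∀ e t, 0 < a e t)
    (hadiff : ∀ e, Differentiable ℝ (a e))
    (hamono : ∀ e (t : ℝ), 0 ≤ deriv (a e) t)
    (hpos : ∀ t ∈ Set.Ici (0 : ℝ), ∀ e, 0 < x t e)
    (hdyn : ∀ t ∈ Set.Ici (0 : ℝ), ∀ e, HasDerivWithinAt (fun s => x s e)
      (a e t * (|p t e| - x t e)) (Set.Ici 0) t)
    (hmin : ∀ t ∈ Set.Ici (0 : ℝ), ∀ s, s ∈ Set.Ici (0 : ℝ) →
      energy c (x t) (p t) ≤ energy c (x t) (p s))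
    (f : Fin m → ℝ)
    (horth : ∀ t ∈ Set.Ici (0 : ℝ), energy c (x t) (p t) ≤
      ∑ e, c e / x t e * (p t e * f e)) :
    ∃ K : ℝ, ∀ T : ℝ, 0 ≤ T →
      T * (energy c (x T) (p T) + ∑ e, c e * x T e - 2 * costVec c f) ≤ K := by
  have hanti := phys_lyap c hc1 x p a ha hpos hdyn hmin
  have hE0 : ∀ t ∈ Set.Ici (0 : ℝ), 0 ≤ energy c (x t) (p t) := fun t ht =>
    Finset.sum_nonneg (fun e _ => by have := hpos t ht e; have := hc1 e; positivity)
  set L0 := energy c (x 0) (p 0) + ∑ e, c e * x 0 e with hL0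
  have hbd : ∀ t ∈ Set.Ici (0 : ℝ), ∀ e, x t e ≤ L0 := by
    intro t ht e
    have h1 := hanti 0 t le_rfl ht
    have h2 : c e * x t e ≤ ∑ e, c e * x t e :=
      Finset.single_le_sum (f := fun e => c e * x t e)
        (fun i _ => mul_nonneg (by linarith [hc1 i]) (hpos t ht i).le) (Finset.mem_univ e)
    have h3 : x t e ≤ c e * x t e := le_mul_of_one_le_left (hpos t ht e).le (hc1 e)
    linarith [hE0 t ht]
  have hL0n : 0 ≤ L0 := add_nonneg (hE0 0 self_mem_Ici)
    (Finset.sum_nonneg (fun e _ => mul_nonneg (by linarith [hc1 e]) (hpos 0 self_mem_Ici e).le))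
  set ℓ := Real.log (L0 + 1) with hℓ
  have hlog : ∀ t ∈ Set.Ici (0 : ℝ), ∀ e, Real.log (x t e) - ℓ ≤ 0 := by
    intro t ht e
    have := Real.log_le_log (hpos t ht e) ((hbd t ht e).trans (by linarith : L0 ≤ L0 + 1))
    linarith
  let G : ℝ → ℝ := fun t => ∑ e, 2 * c e * ((x t e - |f e| * (Real.log (x t e) - ℓ)) / a e t)
  let G' : ℝ → ℝ := fun t => ∑ e, 2 * c e * (((a e t * (|p t e| - x t e)
      - |f e| * ((a e t * (|p t e| - x t e)) / x t e)) * a e t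
      - (x t e - |f e| * (Real.log (x t e) - ℓ)) * deriv (a e) t) / (a e t) ^ 2)
  have hGd : ∀ t ∈ Set.Ici (0 : ℝ), HasDerivWithinAt G (G' t) (Set.Ici 0) t := by
    intro t ht
    refine HasDerivWithinAt.fun_sum fun e _ => ?_
    refine HasDerivWithinAt.const_mul _ ?_
    refine HasDerivWithinAt.fun_div ?_ (hadiff e t).hasDerivAt.hasDerivWithinAt (ha e t).ne'
    refine (hdyn t ht e).fun_sub (HasDerivWithinAt.const_mul _ ?_)
    exact ((hdyn t ht e).log (hpos t ht e).ne').sub_const _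
  have hGn : ∀ t ∈ Set.Ici (0 : ℝ), 0 ≤ G t := by
    intro t ht
    refine Finset.sum_nonneg fun e _ => ?_
    have h1 := hlog t ht e
    have h2 := mul_nonneg (abs_nonneg (f e)) (neg_nonneg.2 h1)
    have := hc1 e
    have := ha e t
    have := hpos t ht e
    exact mul_nonneg (by linarith) (div_nonneg (by linarith) (ha e t).le)
  have hG'le : ∀ t ∈ Set.Ici (0 : ℝ), G' t ≤
      -(energy c (x t) (p t) + ∑ e, c e * x t e - 2 * costVec c f) := by
    intro t ht
    have ho := horth t ht
    have hterm : G' t ≤ ∑ e, (c e / x t e * p t e ^ 2 - c e * x t e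
        - 2 * (c e / x t e * (p t e * f e)) + 2 * (c e * |f e|)) := by
      refine Finset.sum_le_sum fun e _ => ?_
      have hx := hpos t ht e
      have hae := ha e t
      have hce := hc1 e
      have h1 := hlog t ht e
      have h2 := mul_nonneg (abs_nonneg (f e)) (neg_nonneg.2 h1)
      have hd := hamono e t
      have e1 : 2 * c e * (((a e t * (|p t e| - x t e)
          - |f e| * ((a e t * (|p t e| - x t e)) / x t e)) * a e t
          - (x t e - |f e| * (Real.log (x t e) - ℓ)) * deriv (a e) t) / (a e t) ^ 2)
          = 2 * c e * (|p t e| - x t e) - 2 * c e * |f e| * (|p t e| / x t e) + 2 * (c e * |f e|)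
          - 2 * c e * (x t e - |f e| * (Real.log (x t e) - ℓ)) * deriv (a e) t / (a e t) ^ 2 := by
        field_simp; ring
      have e2 : 0 ≤ 2 * c e * (x t e - |f e| * (Real.log (x t e) - ℓ)) * deriv (a e) t
          / (a e t) ^ 2 := by
        have : 0 ≤ x t e - |f e| * (Real.log (x t e) - ℓ) := by linarith
        positivity
      have e3 : 2 * c e * |p t e| ≤ c e / x t e * p t e ^ 2 + c e * x t e := by
        have : c e / x t e * p t e ^ 2 + c e * x t e - 2 * c e * |p t e|
            = c e / x t e * (|p t e| - x t e) ^ 2 := by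
          rw [← sq_abs (p t e)]; field_simp; ring
        have h3 : 0 ≤ c e / x t e * (|p t e| - x t e) ^ 2 := by positivity
        linarith
      have e4 : c e / x t e * (p t e * f e) ≤ c e * |f e| * (|p t e| / x t e) := by
        have h4 : p t e * f e ≤ |p t e| * |f e| := by rw [← abs_mul]; exact le_abs_self _
        have h5 := mul_le_mul_of_nonneg_left h4 (show 0 ≤ c e / x t e by positivity)
        refine h5.trans (le_of_eq ?_)
        ring
      rw [e1]
      linarith
    refine hterm.trans ?_
    rw [Finset.sum_add_distrib, Finset.sum_sub_distrib, Finset.sum_sub_distrib,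
      ← Finset.mul_sum, ← Finset.mul_sum]
    have : ∑ e, c e / x t e * p t e ^ 2 = energy c (x t) (p t) := rfl
    rw [this]
    have : ∑ e, c e * |f e| = costVec c f := rfl
    rw [this]
    linarith
  refine ⟨G 0, fun T hT => ?_⟩
  set κ := energy c (x T) (p T) + ∑ e, c e * x T e - 2 * costVec c f with hκ
  have hsub : Icc 0 T ⊆ Set.Ici 0 := fun t ht => ht.1
  have := image_le_of_deriv_right_le_deriv_boundary (f := G) (f' := G') (a := 0) (b := T)
    (fun t ht => ((hGd t ht.1).continuousWithinAt).mono hsub)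
    (fun t ht => (hGd t ht.1).mono (Set.Ici_subset_Ici.2 ht.1))
    (B := fun t => G 0 - t * κ) (B' := fun _ => -κ) (by simp) (by fun_prop)
    (fun t _ => by
      simpa using (((hasDerivAt_id t).mul_const κ).const_sub (G 0)).hasDerivWithinAt)
    (fun t ht => by
      have h1 := hG'le t ht.1
      have h2 := hanti t T ht.1 ht.2.le
      simp only [hκ]
      linarith)
    (right_mem_Icc.2 hT)
  have h2 := hGn T hT
  linarith

/-- For time-dependent reactivities `a_e(t)` with `ε ≤ a_e(t) ≤ C` and
`ȧ_e(t) ≥ 0`, the solution of `ẋ_e = a_e(t)(|q_e(x)| − x_e)` with positive start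
converges to the optimum `x*` of the weighted basis pursuit problem, and so does
`|q(x(t))|`. -/
theorem nonuniform_physarum_converges_to_optimum {n m : ℕ} (hnm : n ≤ m)
    (A : Matrix (Fin n) (Fin m) ℝ) (b : Fin n → ℝ) (c : Fin m → ℝ)
    (hAZ : ∀ i j, ∃ z : ℤ, A i j = (z : ℝ))
    (hbZ : ∀ i, ∃ z : ℤ, b i = (z : ℝ))
    (hcZ : ∀ e, ∃ z : ℤ, c e = (z : ℝ))
    (hc1 : ∀ e, 1 ≤ c e)
    (hrank : A.rank = n)
    (hfeas : ∃ f : Fin m → ℝ, A.mulVec f = b)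
    (hdistinct : ∀ f g : Fin m → ℝ, IsBFS A b f → IsBFS A b g → f ≠ g →
      costVec c f ≠ costVec c g)
    (xstar : Fin m → ℝ)
    (hopt : ∃ fstar : Fin m → ℝ, A.mulVec fstar = b ∧ (∀ e, |fstar e| ≤ xstar e) ∧
      ∀ (f y : Fin m → ℝ), A.mulVec f = b → (∀ e, |f e| ≤ y e) →
        ∑ e, c e * xstar e ≤ ∑ e, c e * y e)
    (q : (Fin m → ℝ) → Fin m → ℝ)
    (hq : ∀ x : Fin m → ℝ, (∀ e, 0 < x e) →
      A.mulVec (q x) = b ∧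
      ∀ f : Fin m → ℝ, A.mulVec f = b → energy c x (q x) ≤ energy c x f)
    (a : Fin m → ℝ → ℝ) (ε C : ℝ) (hε : 0 < ε) (hεC : ε ≤ C)
    (hadiff : ∀ e, Differentiable ℝ (a e))
    (hab : ∀ e (t : ℝ), ε ≤ a e t ∧ a e t ≤ C)
    (hamono : ∀ e (t : ℝ), 0 ≤ deriv (a e) t)
    (x : ℝ → Fin m → ℝ) (hx₀ : ∀ e, 0 < x 0 e)
    (hpos : ∀ t ∈ Set.Ici (0 : ℝ), ∀ e, 0 < x t e)
    (hdyn : ∀ t ∈ Set.Ici (0 : ℝ), ∀ e, HasDerivWithinAt (fun s => x s e)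
      (a e t * (|q (x t) e| - x t e)) (Set.Ici 0) t) :
    Tendsto x atTop (nhds xstar) ∧
    Tendsto (fun t => fun e => |q (x t) e|) atTop (nhds xstar) := by
  obtain ⟨f0, hf0, hf0x, hbest⟩ := hopt
  have hmin0 : ∀ f, A.mulVec f = b → costVec c f0 ≤ costVec c f := by
    intro f hf
    have h1 := hbest f (fun e => |f e|) hf (fun e => le_rfl)
    have h2 : costVec c f0 ≤ ∑ e, c e * xstar e :=
      Finset.sum_le_sum fun e _ => mul_le_mul_of_nonneg_left (hf0x e) (by linarith [hc1 e])
    exact h2.trans h1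
  have hxs : xstar = fun e => |f0 e| := by
    have h1 := hbest f0 (fun e => |f0 e|) hf0 (fun e => le_rfl)
    have h2 : ∀ e ∈ Finset.univ, c e * |f0 e| ≤ c e * xstar e :=
      fun e _ => mul_le_mul_of_nonneg_left (hf0x e) (by linarith [hc1 e])
    have h3 := (Finset.sum_eq_sum_iff_of_le h2).1 (le_antisymm (Finset.sum_le_sum h2) h1)
    ext e
    exact (mul_left_cancel₀ (by linarith [hc1 e] : c e ≠ 0) (h3 e (Finset.mem_univ e))).symm
  have ha : ∀ e t, 0 < a e t := fun e t => hε.trans_le (hab e t).1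
  have hqf : ∀ t ∈ Set.Ici (0 : ℝ), A.mulVec (q (x t)) = b :=
    fun t ht => (hq (x t) (hpos t ht)).1
  obtain ⟨K, hK⟩ := phys_rate c hc1 x (fun t => q (x t)) a ha hadiff hamono hpos hdyn
    (fun t ht s hs => (hq (x t) (hpos t ht)).2 _ (hqf s hs)) f0
    (fun t ht => phys_orth A b c (x t) (q (x t)) hc1 (hpos t ht) (hqf t ht)
      (hq (x t) (hpos t ht)).2 f0 hf0)
  set D : ℝ → ℝ := fun T =>
    energy c (x T) (q (x T)) + ∑ e, c e * x T e - 2 * costVec c f0 with hD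
  have hgap : ∀ t ∈ Set.Ici (0 : ℝ), ∑ e, c e / x t e * (x t e - |q (x t) e|) ^ 2
      + 2 * (costVec c (q (x t)) - costVec c f0) = D t := by
    intro t ht
    have : ∑ e, c e / x t e * (x t e - |q (x t) e|) ^ 2
        = energy c (x t) (q (x t)) + ∑ e, c e * x t e - 2 * costVec c (q (x t)) := by
      unfold energy costVec
      rw [Finset.mul_sum, ← Finset.sum_add_distrib, ← Finset.sum_sub_distrib]
      refine Finset.sum_congr rfl fun e _ => ?_
      have := hpos t ht e
      rw [← sq_abs (q (x t) e)]
      field_simp; ring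
    rw [this, hD]; ring
  have hterm : ∀ t ∈ Set.Ici (0 : ℝ), ∀ e, 0 ≤ c e / x t e * (x t e - |q (x t) e|) ^ 2 := by
    intro t ht e
    have := hpos t ht e
    have := hc1 e
    positivity
  have hD0 : ∀ t ∈ Set.Ici (0 : ℝ), 0 ≤ D t := by
    intro t ht
    rw [← hgap t ht]
    have := Finset.sum_nonneg (s := Finset.univ) (fun e _ => hterm t ht e)
    linarith [hmin0 _ (hqf t ht)]
  have hDt : Tendsto D atTop (nhds 0) := by
    refine tendsto_of_tendsto_of_tendsto_of_le_of_le' tendsto_const_nhds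
      (tendsto_const_nhds.div_atTop tendsto_id : Tendsto (fun t : ℝ => K / t) atTop (nhds 0)) ?_ ?_
    · filter_upwards [eventually_ge_atTop 0] with t ht using hD0 t ht
    · filter_upwards [eventually_gt_atTop 0] with t ht
      rw [le_div_iff₀ ht, mul_comm]
      exact hK t ht.le
  have hcost : Tendsto (fun t => costVec c (q (x t))) atTop (nhds (costVec c f0)) := by
    refine tendsto_of_tendsto_of_tendsto_of_le_of_le' tendsto_const_nhds
      (by simpa using hDt.const_add (costVec c f0) :
        Tendsto (fun t => costVec c f0 + D t) atTop (nhds (costVec c f0))) ?_ ?_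
    · filter_upwards [eventually_ge_atTop 0] with t ht using hmin0 _ (hqf t ht)
    · filter_upwards [eventually_ge_atTop 0] with t ht
      have h1 := hgap t ht
      have h2 := Finset.sum_nonneg (s := Finset.univ) (fun e _ => hterm t ht e)
      have h3 := hmin0 _ (hqf t ht)
      linarith
  have hqlim : Tendsto (fun t => q (x t)) atTop (nhds f0) := by
    refine (phys_compact A b c hc1 (costVec c f0 + 1)).tendsto_nhds_of_unique_mapClusterPt ?_ ?_
    · filter_upwards [eventually_ge_atTop 0,
        hcost.eventually (gt_mem_nhds (lt_add_one (costVec c f0)))] with t ht h2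
      exact ⟨hqf t ht, h2.le⟩
    · rintro g ⟨hg, -⟩ hcl
      refine phys_unique A b c hc1 hrank hdistinct f0 hf0 hmin0 g hg (le_of_eq ?_)
      have h1 : MapClusterPt (costVec c g) atTop (fun t => costVec c (q (x t))) :=
        hcl.continuousAt_comp (phys_cost_continuous c).continuousAt
      have h2 := h1.clusterPt.mono hcost
      exact eq_of_nhds_neBot h2
  have hqabs : Tendsto (fun t => fun e => |q (x t) e|) atTop (nhds xstar) := by
    rw [hxs, tendsto_pi_nhds]
    intro e
    exact ((tendsto_pi_nhds.1 hqlim) e).abs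
  refine ⟨?_, hqabs⟩
  rw [tendsto_pi_nhds] at hqabs ⊢
  intro e
  have hsq : Tendsto (fun t => (x t e - |q (x t) e|) ^ 2) atTop (nhds 0) := by
    refine tendsto_of_tendsto_of_tendsto_of_le_of_le' tendsto_const_nhds
      (by simpa using (hDt.add_const (2 * costVec c f0)).mul hDt :
        Tendsto (fun t => (D t + 2 * costVec c f0) * D t) atTop (nhds 0)) ?_ ?_
    · exact Eventually.of_forall fun t => sq_nonneg _
    · filter_upwards [eventually_ge_atTop 0] with t ht
      have hx := hpos t ht e
      have hce := hc1 e
      have h1 := Finset.single_le_sum (fun e _ => hterm t ht e) (Finset.mem_univ e)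
      have h2 := hgap t ht
      have h3 := hmin0 _ (hqf t ht)
      have h4 : c e / x t e * (x t e - |q (x t) e|) ^ 2 ≤ D t := by linarith
      have h5 : c e * x t e ≤ ∑ e, c e * x t e :=
        Finset.single_le_sum (f := fun e => c e * x t e)
          (fun i _ => mul_nonneg (by linarith [hc1 i]) (hpos t ht i).le) (Finset.mem_univ e)
      have h6 : x t e ≤ c e * x t e := le_mul_of_one_le_left hx.le hce
      have h7 : 0 ≤ energy c (x t) (q (x t)) := Finset.sum_nonneg (fun e _ => by
        have := hpos t ht e; have := hc1 e; positivity)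
      have h8 : x t e ≤ D t + 2 * costVec c f0 := by simp only [hD]; linarith
      have h9 : (x t e - |q (x t) e|) ^ 2
          ≤ x t e * (c e / x t e * (x t e - |q (x t) e|) ^ 2) := by
        have : x t e * (c e / x t e * (x t e - |q (x t) e|) ^ 2)
            = c e * (x t e - |q (x t) e|) ^ 2 := by field_simp
        rw [this]
        exact le_mul_of_one_le_left (sq_nonneg _) hce
      exact h9.trans (mul_le_mul h8 h4 (hterm t ht e) (by linarith))
  have hdiff : Tendsto (fun t => x t e - |q (x t) e|) atTop (nhds 0) := by
    have h1 := (Real.continuous_sqrt.tendsto 0).comp hsq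
    rw [Real.sqrt_zero] at h1
    rw [tendsto_zero_iff_abs_tendsto_zero]
    refine h1.congr fun t => ?_
    simp [Real.sqrt_sq_eq_abs]
  simpa using hdiff.add (hqabs e)
end

section
/- Assume that any two distinct basic feasible solutions of Af = b have distinct cost, and let x* be the unique optimal solution of the weighted basis pursuit problem. Let x : [0,∞) → ℝ^m be the solution of the uniform Physarum dynamics ẋ_e(t) = |q_e(x(t))| − x_e(t) with x(0) > 0. Then the solution is defined and unique on [0,∞), x(t) > 0 for all t, and both x(t) and |q(x(t))| converge to x* as t → ∞. -/
open Matrix Filter Set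

def MinQ {n m : ℕ} (A : Matrix (Fin n) (Fin m) ℝ) (b : Fin n → ℝ) (c : Fin m → ℝ)
    (q : (Fin m → ℝ) → Fin m → ℝ) : Prop :=
  ∀ x : Fin m → ℝ, (∀ e, 0 < x e) →
      A.mulVec (q x) = b ∧
      ∀ f : Fin m → ℝ, A.mulVec f = b → energy c x (q x) ≤ energy c x f

lemma minQ_orth {n m : ℕ} {A : Matrix (Fin n) (Fin m) ℝ} {b : Fin n → ℝ} {c : Fin m → ℝ}
    {q : (Fin m → ℝ) → Fin m → ℝ} (hq : MinQ A b c q) (hc1 : ∀ e, 1 ≤ c e)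
    {x : Fin m → ℝ} (hx : ∀ e, 0 < x e) {f : Fin m → ℝ} (hf : A.mulVec f = b) :
    ∑ e, c e / x e * q x e * (f e - q x e) = 0 := by
  obtain ⟨h1, h2⟩ := hq x hx
  set I := ∑ e, c e / x e * q x e * (f e - q x e) with hI
  set J := ∑ e, c e / x e * (f e - q x e) ^ 2 with hJ
  have hJ0 : 0 ≤ J := Finset.sum_nonneg fun e _ => by
    have := hx e; have := hc1 e; positivity
  have key : ∀ s : ℝ, 0 ≤ 2 * s * I + s ^ 2 * J := by
    intro s
    have hA : A.mulVec (q x + s • (f - q x)) = b := by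
      rw [Matrix.mulVec_add, Matrix.mulVec_smul, Matrix.mulVec_sub, hf, h1]; simp
    have := h2 _ hA
    have e1 : energy c x (q x + s • (f - q x)) = energy c x (q x) + (2 * s * I + s ^ 2 * J) := by
      simp only [energy, hI, hJ, Finset.mul_sum, ← Finset.sum_add_distrib]
      refine Finset.sum_congr rfl fun e _ => ?_
      simp only [Pi.add_apply, Pi.smul_apply, Pi.sub_apply, smul_eq_mul]
      ring
    linarith
  have h := key (-I / (J + 1))
  have hJ1 : 0 < J + 1 := by linarith
  have e2 : 2 * (-I / (J + 1)) * I + (-I / (J + 1)) ^ 2 * J = -(I ^ 2 * (J + 2)) / (J + 1) ^ 2 := by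
    field_simp; ring
  rw [e2] at h
  have h3 : 0 ≤ -(I ^ 2 * (J + 2)) := by
    by_contra hn
    push Not at hn
    have := div_neg_of_neg_of_pos hn (by positivity : 0 < (J + 1) ^ 2)
    linarith
  have h4 : I ^ 2 = 0 := by nlinarith [sq_nonneg I]
  exact pow_eq_zero_iff (two_ne_zero) |>.1 h4

lemma energy_term_le {m : ℕ} {c x : Fin m → ℝ} (hc1 : ∀ e, 1 ≤ c e) (hx : ∀ e, 0 < x e)
    (f : Fin m → ℝ) (e : Fin m) : f e ^ 2 ≤ x e * energy c x f := by
  have h1 : c e / x e * f e ^ 2 ≤ energy c x f :=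
    Finset.single_le_sum (f := fun e => c e / x e * f e ^ 2) (fun e _ => by
      have := hx e; have := hc1 e; positivity) (Finset.mem_univ e)
  have h2 : x e * (c e / x e * f e ^ 2) = c e * f e ^ 2 := by have := (hx e).ne'; field_simp
  have h3 := mul_le_mul_of_nonneg_left h1 (hx e).le
  nlinarith [hc1 e, sq_nonneg (f e)]

lemma energy_lo {m : ℕ} {c : Fin m → ℝ} (hc1 : ∀ e, 1 ≤ c e) {lo : ℝ} (hlo : 0 < lo)
    {x : Fin m → ℝ} (hx : ∀ e, lo ≤ x e) (f : Fin m → ℝ) :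
    energy c x f ≤ energy c (fun _ => lo) f := by
  refine Finset.sum_le_sum fun e _ => ?_
  have := hx e; have := hc1 e
  gcongr

/-- Bound for `q` on a box. -/
lemma q_bound {n m : ℕ} {A : Matrix (Fin n) (Fin m) ℝ} {b : Fin n → ℝ} {c : Fin m → ℝ}
    {q : (Fin m → ℝ) → Fin m → ℝ} (hq : MinQ A b c q) (hc1 : ∀ e, 1 ≤ c e)
    {f0 : Fin m → ℝ} (hf0 : A.mulVec f0 = b) {lo : ℝ} (hlo : 0 < lo)
    {x : Fin m → ℝ} (hx : ∀ e, lo ≤ x e) (e : Fin m) :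
    q x e ^ 2 ≤ x e * energy c (fun _ => lo) f0 := by
  have hx0 : ∀ e, 0 < x e := fun e => hlo.trans_le (hx e)
  refine (energy_term_le hc1 hx0 _ e).trans ?_
  exact mul_le_mul_of_nonneg_left (((hq x hx0).2 f0 hf0).trans (energy_lo hc1 hlo hx f0)) (hx0 e).le

lemma energy_nonneg {m : ℕ} {c x : Fin m → ℝ} (hc1 : ∀ e, 1 ≤ c e) (hx : ∀ e, 0 < x e)
    (f : Fin m → ℝ) : 0 ≤ energy c x f :=
  Finset.sum_nonneg fun e _ => by have := hx e; have := hc1 e; positivity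

lemma q_lipschitz {n m : ℕ} {A : Matrix (Fin n) (Fin m) ℝ} {b : Fin n → ℝ} {c : Fin m → ℝ}
    {q : (Fin m → ℝ) → Fin m → ℝ} (hq : MinQ A b c q) (hc1 : ∀ e, 1 ≤ c e)
    {f0 : Fin m → ℝ} (hf0 : A.mulVec f0 = b) {lo hi : ℝ} (hlo : 0 < lo) (hlh : lo ≤ hi) :
    ∃ K : NNReal, LipschitzOnWith K q {x | ∀ e, lo ≤ x e ∧ x e ≤ hi} := by
  set C0 := energy c (fun _ => lo) f0 with hC0
  have hC0' : 0 ≤ C0 := energy_nonneg hc1 (fun _ => hlo) f0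
  have hhi : 0 < hi := hlo.trans_le hlh
  set Q := hi * C0 + 1 with hQ
  have hQ0 : 0 ≤ Q := by positivity
  set S := ∑ e, c e with hS
  have hS0 : 0 ≤ S := Finset.sum_nonneg fun e _ => by have := hc1 e; linarith
  set K := hi * (S * Q / lo ^ 2) with hK
  have hK0 : 0 ≤ K := by positivity
  refine ⟨K.toNNReal, LipschitzOnWith.of_dist_le_mul fun x hx y hy => ?_⟩
  rw [Real.coe_toNNReal _ hK0, dist_eq_norm, dist_eq_norm]
  have hx0 : ∀ e, 0 < x e := fun e => hlo.trans_le (hx e).1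
  have hy0 : ∀ e, 0 < y e := fun e => hlo.trans_le (hy e).1
  have o1 := minQ_orth hq hc1 hx0 (hq y hy0).1
  have o2 := minQ_orth hq hc1 hy0 (hq x hx0).1
  set d := q x - q y with hd
  have hqy : ∀ e, |q y e| ≤ Q := fun e => by
    have h := q_bound hq hc1 hf0 hlo (fun e => (hy e).1) e
    have h2 : q y e ^ 2 ≤ hi * C0 := h.trans (mul_le_mul_of_nonneg_right (hy e).2 hC0')
    have : 0 ≤ hi * C0 := by positivity
    refine abs_le_of_sq_le_sq ?_ hQ0
    nlinarith
  have hmain : ∑ e, c e / x e * d e ^ 2 ≤ S * Q / lo ^ 2 * ‖x - y‖ * ‖d‖ := by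
    have e1 : ∑ e, c e / x e * d e ^ 2 = ∑ e, c e * ((x e - y e) / (x e * y e)) * q y e * d e := by
      have : ∑ e, c e / x e * d e ^ 2 - ∑ e, c e * ((x e - y e) / (x e * y e)) * q y e * d e
        = -(∑ e, c e / x e * q x e * (q y e - q x e)) - ∑ e, c e / y e * q y e * (q x e - q y e) := by
        rw [← Finset.sum_neg_distrib, ← Finset.sum_sub_distrib, ← Finset.sum_sub_distrib]
        refine Finset.sum_congr rfl fun e _ => ?_
        have := (hx0 e).ne'; have := (hy0 e).ne'
        simp only [hd, Pi.sub_apply]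
        field_simp; ring
      rw [o1, o2] at this; linarith
    rw [e1]
    have : S * Q / lo ^ 2 * ‖x - y‖ * ‖d‖ = ∑ e, c e * (‖x - y‖ / lo ^ 2) * Q * ‖d‖ := by
      rw [hS]; simp only [← Finset.sum_mul]; ring
    rw [this]
    refine Finset.sum_le_sum fun e _ => ?_
    refine (le_abs_self _).trans ?_
    rw [abs_mul, abs_mul, abs_mul, abs_div]
    have hce : |c e| = c e := abs_of_nonneg (by linarith [hc1 e])
    have h1 : |x e - y e| ≤ ‖x - y‖ := norm_le_pi_norm (x - y) e
    have h2 : |d e| ≤ ‖d‖ := norm_le_pi_norm d e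
    have h3 : lo ^ 2 ≤ |x e * y e| := by
      rw [abs_of_pos (mul_pos (hx0 e) (hy0 e)), sq]
      exact mul_le_mul (hx e).1 (hy e).1 hlo.le (hx0 e).le
    have h4 := hqy e
    have := hc1 e
    rw [hce]
    gcongr
  have hd2 : ‖d‖ ≤ Real.sqrt (K * ‖x - y‖ * ‖d‖) := by
    rw [pi_norm_le_iff_of_nonneg (Real.sqrt_nonneg _)]
    intro e
    rw [Real.norm_eq_abs]
    apply Real.abs_le_sqrt
    refine (energy_term_le hc1 hx0 d e).trans ?_
    have : K * ‖x - y‖ * ‖d‖ = hi * (S * Q / lo ^ 2 * ‖x - y‖ * ‖d‖) := by rw [hK]; ring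
    rw [this]
    exact mul_le_mul (hx e).2 hmain (energy_nonneg hc1 hx0 d) hhi.le
  have hsq : ‖d‖ ^ 2 ≤ K * ‖x - y‖ * ‖d‖ :=
    (Real.le_sqrt (norm_nonneg d) (by positivity)).1 hd2
  rcases eq_or_lt_of_le (norm_nonneg d) with h | h
  · rw [← h]; positivity
  · nlinarith

lemma q_continuousAt {n m : ℕ} {A : Matrix (Fin n) (Fin m) ℝ} {b : Fin n → ℝ} {c : Fin m → ℝ}
    {q : (Fin m → ℝ) → Fin m → ℝ} (hq : MinQ A b c q) (hc1 : ∀ e, 1 ≤ c e)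
    {f0 : Fin m → ℝ} (hf0 : A.mulVec f0 = b) {x : Fin m → ℝ} (hx : ∀ e, 0 < x e) :
    ContinuousAt q x := by
  obtain ⟨lo, hlo, hlo'⟩ : ∃ lo > 0, ∀ e, lo < x e := by
    have : ∀ᶠ lo in nhdsWithin (0:ℝ) (Ioi 0), ∀ e, lo < x e :=
      eventually_all.2 fun e => eventually_nhdsWithin_of_eventually_nhds (eventually_lt_nhds (hx e))
    exact (this.and self_mem_nhdsWithin).exists.imp fun a h => ⟨h.2, h.1⟩
  obtain ⟨hi, hhi, hhi'⟩ : ∃ hi > lo, ∀ e, x e < hi := by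
    have : ∀ᶠ hi in (atTop : Filter ℝ), ∀ e, x e < hi :=
      eventually_all.2 fun e => eventually_gt_atTop _
    exact (this.and (eventually_gt_atTop lo)).exists.imp fun a h => ⟨h.2, h.1⟩
  obtain ⟨K, hK⟩ := q_lipschitz hq hc1 hf0 hlo hhi.le
  refine hK.continuousOn.continuousAt ?_
  have : ∀ᶠ y in nhds x, ∀ e, lo ≤ y e ∧ y e ≤ hi := eventually_all.2 fun e => by
    have h1 : ∀ᶠ y in nhds x, lo < y e := (continuous_apply e).continuousAt.eventually_const_lt (hlo' e)
    have h2 : ∀ᶠ y in nhds x, y e < hi := (continuous_apply e).continuousAt.eventually_lt_const (hhi' e)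
    filter_upwards [h1, h2] with y a b using ⟨a.le, b.le⟩
  exact this

lemma exists_lo {m : ℕ} {x : Fin m → ℝ} (hx : ∀ e, 0 < x e) : ∃ lo > 0, ∀ e, lo < x e := by
  have : ∀ᶠ lo in nhdsWithin (0:ℝ) (Ioi 0), ∀ e, lo < x e :=
    eventually_all.2 fun e => eventually_nhdsWithin_of_eventually_nhds (eventually_lt_nhds (hx e))
  exact (this.and self_mem_nhdsWithin).exists.imp fun a h => ⟨h.2, h.1⟩

lemma exists_sol_Icc {n m : ℕ} {A : Matrix (Fin n) (Fin m) ℝ} {b : Fin n → ℝ} {c : Fin m → ℝ}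
    {q : (Fin m → ℝ) → Fin m → ℝ} (hq : MinQ A b c q) (hc1 : ∀ e, 1 ≤ c e)
    {f0 : Fin m → ℝ} (hf0 : A.mulVec f0 = b) {x₀ : Fin m → ℝ} (hx : ∀ e, 0 < x₀ e)
    {T : ℝ} (hT : 0 ≤ T) :
    ∃ z : ℝ → Fin m → ℝ, z 0 = x₀ ∧ ∀ t ∈ Icc 0 T, (∀ e, 0 < z t e) ∧
      HasDerivWithinAt z (fun e => |q (z t) e| - z t e) (Icc 0 T) t := by
  obtain ⟨lo0, hlo0, hlo0'⟩ := exists_lo hx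
  set lo := lo0 * Real.exp (-2 * T) with hlodef
  have hlo : 0 < lo := by positivity
  set C := energy c (fun _ => lo) f0 with hC
  have hC0 : 0 ≤ C := energy_nonneg hc1 (fun _ => hlo) f0
  obtain ⟨hi, hhi1, hhi2, hhi3⟩ : ∃ hi, lo < hi ∧ C < hi ∧ ∀ e, x₀ e < hi := by
    have : ∀ᶠ hi in (atTop : Filter ℝ), ∀ e, x₀ e < hi :=
      eventually_all.2 fun e => eventually_gt_atTop _
    exact ((eventually_gt_atTop lo).and ((eventually_gt_atTop C).and this)).exists
  have hhi : 0 < hi := hlo.trans hhi1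
  obtain ⟨K, hK⟩ := q_lipschitz hq hc1 hf0 hlo hhi1.le
  set P : (Fin m → ℝ) → Fin m → ℝ := fun z e => max lo (min (z e) hi) with hP
  have hPmem : ∀ z, P z ∈ {x : Fin m → ℝ | ∀ e, lo ≤ x e ∧ x e ≤ hi} := fun z e =>
    ⟨le_max_left _ _, max_le hhi1.le (min_le_right _ _)⟩
  have hPlip : ∀ z w, dist (P z) (P w) ≤ dist z w := fun z w => by
    refine (dist_pi_le_iff dist_nonneg).2 fun e => ?_
    refine le_trans ?_ (dist_le_pi_dist z w e)
    simp only [hP, Real.dist_eq]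
    refine (abs_max_sub_max_le_max _ _ _ _).trans ?_
    simp only [sub_self, abs_zero]
    refine max_le (abs_nonneg _) ?_
    refine (abs_min_sub_min_le_max _ _ _ _).trans ?_
    simp
  have hqP : ∀ z e, |q (P z) e| < hi := fun z e => by
    have h := q_bound hq hc1 hf0 hlo (fun e => (hPmem z e).1) e
    have h2 : q (P z) e ^ 2 ≤ hi * C := h.trans (mul_le_mul_of_nonneg_right (hPmem z e).2 hC0)
    refine abs_lt_of_sq_lt_sq ?_ hhi.le
    nlinarith
  set v : (Fin m → ℝ) → Fin m → ℝ := fun z e => |q (P z) e| - P z e with hv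
  have hvlip : LipschitzWith (K + 1) v := by
    refine LipschitzWith.of_dist_le_mul fun z w => ?_
    refine (dist_pi_le_iff (by positivity)).2 fun e => ?_
    have h1 := hK.dist_le_mul _ (hPmem z) _ (hPmem w)
    have h2 := hPlip z w
    have h3 := (dist_le_pi_dist _ _ e).trans h1
    have h4 := (dist_le_pi_dist _ _ e).trans h2
    rw [Real.dist_eq] at h3 h4 ⊢
    simp only [hv]
    have h5 := abs_abs_sub_abs_le (q (P z) e) (q (P w) e)
    have h6 : (K:ℝ) * dist (P z) (P w) ≤ K * dist z w := mul_le_mul_of_nonneg_left h2 K.2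
    push_cast
    calc _ = |(|q (P z) e| - |q (P w) e|) - (P z e - P w e)| := by congr 1; ring
      _ ≤ _ := abs_sub _ _
      _ ≤ _ := by nlinarith
  have hvb : ∀ z, ‖v z‖ ≤ 2 * hi := fun z => by
    refine (pi_norm_le_iff_of_nonneg (by positivity)).2 fun e => ?_
    rw [Real.norm_eq_abs, abs_le]
    simp only [hv]
    have := hqP z e; have := hPmem z e; have := abs_nonneg (q (P z) e)
    constructor <;> linarith [(hPmem z e).1, (hPmem z e).2]
  have hpl : IsPicardLindelof (fun _ : ℝ => v) (tmin := 0) (tmax := T) ⟨0, le_rfl, hT⟩ x₀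
      ((2 * hi).toNNReal * T.toNNReal) 0 (2 * hi).toNNReal (K + 1) := by
    refine IsPicardLindelof.of_time_independent (fun x _ => ?_) hvlip.lipschitzOnWith ?_
    · rw [Real.coe_toNNReal _ (by positivity)]; exact hvb x
    · push_cast
      rw [Real.coe_toNNReal _ hT]
      simp [hT]
  obtain ⟨z, hz0, hz⟩ := hpl.exists_eq_forall_mem_Icc_hasDerivWithinAt₀
  simp only at hz0
  have hze : ∀ e, ∀ t ∈ Icc 0 T, HasDerivWithinAt (fun s => z s e) (v (z t) e) (Icc 0 T) t :=
    fun e t ht => hasDerivWithinAt_pi.1 (hz t ht) e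
  have hcont : ∀ e, ContinuousOn (fun s => z s e) (Icc 0 T) := fun e =>
    HasDerivWithinAt.continuousOn (hze e)
  have hright : ∀ e, ∀ t ∈ Ico 0 T, HasDerivWithinAt (fun s => z s e) (v (z t) e) (Ici t) t :=
    fun e t ht => ((hze e t ⟨ht.1, ht.2.le⟩).mono_of_mem_nhdsWithin
      (by
        refine mem_of_superset (Icc_mem_nhdsGE ht.2) (Icc_subset_Icc_left ht.1)))
  have hup : ∀ e, ∀ t ∈ Icc 0 T, z t e ≤ hi := fun e => by
    refine image_le_of_deriv_right_lt_deriv_boundary (hcont e) (hright e) (B := fun _ => hi)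
      (B' := fun _ => 0) ?_ (fun x => hasDerivAt_const _ _) ?_
    · simp only [hz0]; exact (hhi3 e).le
    · intro t ht heq
      simp only [hv]
      have : P (z t) e = hi := by simp only [hP, heq, min_self]; exact max_eq_right hhi1.le
      rw [this]; linarith [hqP (z t) e]
  have hdn' : ∀ e, ∀ t ∈ Icc 0 T, -z t e ≤ -(x₀ e * Real.exp (-2 * t)) := fun e => by
    refine image_le_of_deriv_right_lt_deriv_boundary (f := fun t => - z t e)
      (f' := fun t => -(v (z t) e)) (hcont e).neg (fun t ht => (hright e t ht).neg)
      (B := fun t => -(x₀ e * Real.exp (-2 * t)))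
      (B' := fun t => 2 * (x₀ e * Real.exp (-2 * t))) ?_ ?_ ?_
    · simp [hz0]
    · intro t
      have h := (((hasDerivAt_id t).const_mul (-2)).exp.const_mul (x₀ e)).neg
      refine h.congr_deriv ?_
      simp only [id]; ring
    · intro t ht heq
      have heq' : z t e = x₀ e * Real.exp (-2 * t) := neg_injective heq
      have hp : 0 < x₀ e * Real.exp (-2 * t) := mul_pos (hx e) (Real.exp_pos _)
      have hl : lo ≤ z t e := by
        rw [heq', hlodef]
        have := (hlo0' e).le
        have h2 := ht.2.le
        have : Real.exp (-2 * T) ≤ Real.exp (-2 * t) := Real.exp_le_exp.2 (by linarith)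
        have := hx e
        gcongr
      have hPz : P (z t) e ≤ z t e := max_le hl (min_le_left _ _)
      simp only [hv]
      have := abs_nonneg (q (P (z t)) e)
      rw [← heq'] at hp ⊢
      linarith
  have hdn : ∀ e, ∀ t ∈ Icc 0 T, x₀ e * Real.exp (-2 * t) ≤ z t e :=
    fun e t ht => neg_le_neg_iff.1 (hdn' e t ht)
  refine ⟨z, hz0, fun t ht => ⟨fun e => ?_, ?_⟩⟩
  · exact (mul_pos (hx e) (Real.exp_pos _)).trans_le (hdn e t ht)
  · have hPz : P (z t) = z t := by
      funext e
      have hl : lo ≤ z t e := by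
        refine le_trans ?_ (hdn e t ht)
        rw [hlodef]
        have := (hlo0' e).le
        have h2 := ht.2
        have : Real.exp (-2 * T) ≤ Real.exp (-2 * t) := Real.exp_le_exp.2 (by linarith)
        have := hx e
        gcongr
      simp only [hP]
      rw [min_eq_left (hup e t ht), max_eq_right hl]
    have := hz t ht
    simp only [hv, hPz] at this
    exact this

lemma sol_unique {n m : ℕ} {A : Matrix (Fin n) (Fin m) ℝ} {b : Fin n → ℝ} {c : Fin m → ℝ}
    {q : (Fin m → ℝ) → Fin m → ℝ} (hq : MinQ A b c q) (hc1 : ∀ e, 1 ≤ c e)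
    {f0 : Fin m → ℝ} (hf0 : A.mulVec f0 = b)
    {T : ℝ} {y z : ℝ → Fin m → ℝ} (h0 : y 0 = z 0)
    (hy : ∀ t ∈ Icc 0 T, (∀ e, 0 < y t e) ∧
      HasDerivWithinAt y (fun e => |q (y t) e| - y t e) (Icc 0 T) t)
    (hz : ∀ t ∈ Icc 0 T, (∀ e, 0 < z t e) ∧
      HasDerivWithinAt z (fun e => |q (z t) e| - z t e) (Icc 0 T) t) :
    EqOn y z (Icc 0 T) := by
  rcases lt_or_ge T 0 with hT | hT
  · rw [Icc_eq_empty (not_le.2 hT)]; exact fun _ h => h.elim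
  have hyc : ContinuousOn y (Icc 0 T) := HasDerivWithinAt.continuousOn fun t ht => (hy t ht).2
  have hzc : ContinuousOn z (Icc 0 T) := HasDerivWithinAt.continuousOn fun t ht => (hz t ht).2
  have box : ∀ w : ℝ → Fin m → ℝ, ContinuousOn w (Icc 0 T) → (∀ t ∈ Icc 0 T, ∀ e, 0 < w t e) →
      ∃ lo > 0, ∃ hi, ∀ t ∈ Icc 0 T, ∀ e, lo ≤ w t e ∧ w t e ≤ hi := by
    intro w hw hpos
    have hce : ∀ e, ContinuousOn (fun t => w t e) (Icc 0 T) := fun e => continuousOn_pi.1 hw e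
    have hne : (Icc 0 T).Nonempty := nonempty_Icc.2 hT
    choose t1 ht1 hm1 using fun e => isCompact_Icc.exists_isMinOn hne (hce e)
    choose t2 ht2 hm2 using fun e => isCompact_Icc.exists_isMaxOn hne (hce e)
    obtain ⟨lo, hlo, hlo'⟩ := exists_lo (x := fun e => w (t1 e) e) fun e => hpos _ (ht1 e) e
    obtain ⟨hi, hhi⟩ : ∃ hi, ∀ e, w (t2 e) e < hi :=
      (eventually_all.2 fun e => eventually_gt_atTop (w (t2 e) e) :
        ∀ᶠ hi in (atTop : Filter ℝ), ∀ e, w (t2 e) e < hi).exists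
    exact ⟨lo, hlo, hi, fun t ht e => ⟨(hlo' e).le.trans (hm1 e ht), le_trans (hm2 e ht) (hhi e).le⟩⟩
  obtain ⟨l1, hl1, h1, hb1⟩ := box y hyc fun t ht => (hy t ht).1
  obtain ⟨l2, hl2, h2, hb2⟩ := box z hzc fun t ht => (hz t ht).1
  have hlo : 0 < min l1 l2 := lt_min hl1 hl2
  obtain ⟨K, hK⟩ := q_lipschitz hq hc1 hf0 hlo (le_max_left (min l1 l2) (max h1 h2))
  set S := {x : Fin m → ℝ | ∀ e, min l1 l2 ≤ x e ∧ x e ≤ max (min l1 l2) (max h1 h2)} with hS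
  set v : (Fin m → ℝ) → Fin m → ℝ := fun z e => |q z e| - z e with hv
  have hvlip : LipschitzOnWith (K + 1) v S := by
    refine LipschitzOnWith.of_dist_le_mul fun z hz w hw => ?_
    refine (dist_pi_le_iff (by positivity)).2 fun e => ?_
    have h1 := hK.dist_le_mul _ hz _ hw
    have h3 := (dist_le_pi_dist _ _ e).trans h1
    have h4 := (dist_le_pi_dist z w e)
    rw [Real.dist_eq] at h3 h4 ⊢
    simp only [hv]
    have h5 := abs_abs_sub_abs_le (q z e) (q w e)
    push_cast
    calc _ = |(|q z e| - |q w e|) - (z e - w e)| := by congr 1; ring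
      _ ≤ _ := abs_sub _ _
      _ ≤ _ := by nlinarith
  have right : ∀ w : ℝ → Fin m → ℝ, (∀ t ∈ Icc 0 T, (∀ e, 0 < w t e) ∧
      HasDerivWithinAt w (fun e => |q (w t) e| - w t e) (Icc 0 T) t) →
      ∀ t ∈ Ico 0 T, HasDerivWithinAt w (v (w t)) (Ici t) t := fun w hw t ht =>
    ((hw t ⟨ht.1, ht.2.le⟩).2.mono_of_mem_nhdsWithin
      (mem_of_superset (Icc_mem_nhdsGE ht.2) (Icc_subset_Icc_left ht.1)))
  refine ODE_solution_unique_of_mem_Icc_right (v := fun _ => v) (s := fun _ => S)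
    (fun _ _ => hvlip) hyc (right y hy) (fun t ht e => ?_) hzc (right z hz) (fun t ht e => ?_) h0
  · have := hb1 t ⟨ht.1, ht.2.le⟩ e
    exact ⟨(min_le_left _ _).trans this.1,
      this.2.trans ((le_max_left _ _).trans (le_max_right _ _))⟩
  · have := hb2 t ⟨ht.1, ht.2.le⟩ e
    exact ⟨(min_le_right _ _).trans this.1,
      this.2.trans ((le_max_right _ _).trans (le_max_right _ _))⟩

lemma exists_sol {n m : ℕ} {A : Matrix (Fin n) (Fin m) ℝ} {b : Fin n → ℝ} {c : Fin m → ℝ}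
    {q : (Fin m → ℝ) → Fin m → ℝ} (hq : MinQ A b c q) (hc1 : ∀ e, 1 ≤ c e)
    {f0 : Fin m → ℝ} (hf0 : A.mulVec f0 = b) {x₀ : Fin m → ℝ} (hx : ∀ e, 0 < x₀ e) :
    ∃ x : ℝ → Fin m → ℝ, x 0 = x₀ ∧ ∀ t ∈ Ici (0:ℝ), (∀ e, 0 < x t e) ∧
      HasDerivWithinAt x (fun e => |q (x t) e| - x t e) (Ici 0) t := by
  choose z hz0 hz using fun N : ℕ => exists_sol_Icc hq hc1 hf0 hx (T := N) N.cast_nonneg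
  have agree : ∀ N M : ℕ, N ≤ M → EqOn (z N) (z M) (Icc 0 (N:ℝ)) := fun N M h => by
    have hsub : Icc 0 (N:ℝ) ⊆ Icc 0 (M:ℝ) := Icc_subset_Icc_right (by exact_mod_cast h)
    refine sol_unique hq hc1 hf0 (by rw [hz0, hz0]) (hz N) fun t ht => ?_
    exact ⟨(hz M t (hsub ht)).1, (hz M t (hsub ht)).2.mono hsub⟩
  set x : ℝ → Fin m → ℝ := fun t => z ⌈t⌉₊ t with hxdef
  have hxz : ∀ N : ℕ, ∀ t ∈ Icc 0 (N:ℝ), x t = z N t := fun N t ht =>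
    agree _ _ (Nat.ceil_le.2 ht.2) ⟨ht.1, Nat.le_ceil t⟩
  refine ⟨x, by rw [hxz 0 0 (by simp), hz0], fun t ht => ?_⟩
  have ht0 : 0 ≤ t := ht
  obtain ⟨N, hN⟩ := exists_nat_gt t
  have htm : t ∈ Icc 0 (N:ℝ) := ⟨ht, hN.le⟩
  rw [hxz N t htm]
  refine ⟨(hz N t htm).1, ?_⟩
  have h1 := (hz N t htm).2.congr (fun s hs => hxz N s hs) (hxz N t htm)
  refine h1.mono_of_mem_nhdsWithin ?_
  have : Iio (N:ℝ) ∈ nhds t := Iio_mem_nhds hN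
  filter_upwards [self_mem_nhdsWithin, mem_nhdsWithin_of_mem_nhds this] with s h1 h2
  exact ⟨h1, le_of_lt h2⟩

/-- Lyapunov function. -/
noncomputable def lyap {m : ℕ} (c : Fin m → ℝ) (q : (Fin m → ℝ) → Fin m → ℝ) (x : Fin m → ℝ) : ℝ :=
  ∑ e, c e * x e + energy c x (q x)

lemma lyap_eq {m : ℕ} {c : Fin m → ℝ} {q : (Fin m → ℝ) → Fin m → ℝ} {x : Fin m → ℝ}
    (hx : ∀ e, 0 < x e) :
    lyap c q x = 2 * costVec c (q x) + ∑ e, c e * (|q x e| - x e) ^ 2 / x e := by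
  simp only [lyap, energy, costVec, Finset.mul_sum, ← Finset.sum_add_distrib]
  refine Finset.sum_congr rfl fun e _ => ?_
  have := (hx e).ne'
  rw [← sq_abs (q x e)]
  field_simp; ring

lemma lyap_anti {n m : ℕ} {A : Matrix (Fin n) (Fin m) ℝ} {b : Fin n → ℝ} {c : Fin m → ℝ}
    {q : (Fin m → ℝ) → Fin m → ℝ} (hq : MinQ A b c q) (hc1 : ∀ e, 1 ≤ c e)
    {f0 : Fin m → ℝ} (hf0 : A.mulVec f0 = b) {x : ℝ → Fin m → ℝ}
    (hx : ∀ t ∈ Ici (0:ℝ), (∀ e, 0 < x t e) ∧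
      HasDerivWithinAt x (fun e => |q (x t) e| - x t e) (Ici 0) t) {s t : ℝ} (hs : 0 ≤ s)
    (hst : s ≤ t) : lyap c q (x t) ≤ lyap c q (x s) := by
  have hcx : ContinuousOn x (Ici 0) := HasDerivWithinAt.continuousOn fun t ht => (hx t ht).2
  have hcq : ContinuousOn (fun t => q (x t)) (Ici 0) := fun t ht =>
    (q_continuousAt hq hc1 hf0 (hx t ht).1).comp_continuousWithinAt (hcx t ht)
  have hcV : ContinuousOn (fun t => lyap c q (x t)) (Ici 0) := by
    simp only [lyap, energy]
    refine ContinuousOn.add (continuousOn_finsetSum _ fun e _ => ?_)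
      (continuousOn_finsetSum _ fun e _ => ?_)
    · exact continuousOn_const.mul (continuousOn_pi.1 hcx e)
    · exact (continuousOn_const.div (continuousOn_pi.1 hcx e) fun t ht => ((hx t ht).1 e).ne').mul
        ((continuousOn_pi.1 hcq e).pow 2)
  refine image_le_of_liminf_slope_right_le_deriv_boundary (f := fun t => lyap c q (x t))
    (a := s) (b := t) (hcV.mono fun u hu => hs.trans hu.1) (B := fun _ => lyap c q (x s))
    (B' := fun _ => 0) le_rfl continuousOn_const (fun _ _ => hasDerivWithinAt_const _ _ _) ?_
    ⟨hst, le_rfl⟩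
  intro u hu r hr
  have hu0 : (0:ℝ) ≤ u := hs.trans hu.1
  obtain ⟨hpos, hder⟩ := hx u hu0
  have hder' : ∀ e, HasDerivWithinAt (fun s => x s e) (|q (x u) e| - x u e) (Ici u) u := fun e =>
    (hasDerivWithinAt_pi.1 hder e).mono (Ici_subset_Ici.2 hu0)
  set H : ℝ → ℝ := fun z => ∑ e, c e * x z e + energy c (x z) (q (x u)) with hH
  have hHd : HasDerivWithinAt H (∑ e, c e * (|q (x u) e| - x u e) +
      ∑ e, (0 * x u e - c e * (|q (x u) e| - x u e)) / (x u e) ^ 2 * q (x u) e ^ 2) (Ici u) u := by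
    simp only [hH, energy]
    refine HasDerivWithinAt.add ?_ ?_
    · exact HasDerivWithinAt.fun_sum fun e _ => (hder' e).const_mul _
    · exact HasDerivWithinAt.fun_sum fun e _ =>
        (((hasDerivWithinAt_const u _ (c e)).div (hder' e) (hpos e).ne').mul_const _)
  have hneg : (∑ e, c e * (|q (x u) e| - x u e) +
      ∑ e, (0 * x u e - c e * (|q (x u) e| - x u e)) / (x u e) ^ 2 * q (x u) e ^ 2) ≤ 0 := by
    rw [← Finset.sum_add_distrib]
    refine Finset.sum_nonpos fun e _ => ?_
    have h1 := hpos e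
    have h2 := hc1 e
    have h3 := abs_nonneg (q (x u) e)
    have : c e * (|q (x u) e| - x u e) +
        (0 * x u e - c e * (|q (x u) e| - x u e)) / (x u e) ^ 2 * q (x u) e ^ 2
        = -(c e * (|q (x u) e| - x u e) ^ 2 * (|q (x u) e| + x u e) / (x u e) ^ 2) := by
      rw [← sq_abs (q (x u) e)]
      field_simp; ring
    rw [this, neg_nonpos]
    positivity
  have hfr := hHd.liminf_right_slope_le (lt_of_le_of_lt hneg hr)
  refine (hfr.and_eventually self_mem_nhdsWithin).mono fun z ⟨hz, hzu⟩ => ?_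
  refine lt_of_le_of_lt ?_ hz
  have hzu' : u < z := hzu
  rw [slope_def_field, slope_def_field]
  have h0 : 0 < z - u := sub_pos.2 hzu'
  have : lyap c q (x z) ≤ H z :=
    add_le_add le_rfl ((hq (x z) (hx z (hu0.trans hzu'.le)).1).2 _ (hq (x u) hpos).1)
  have h2 : lyap c q (x u) = H u := rfl
  rw [h2]
  gcongr

lemma le_lyap {m : ℕ} {c : Fin m → ℝ} {q : (Fin m → ℝ) → Fin m → ℝ} {x : Fin m → ℝ}
    (hc1 : ∀ e, 1 ≤ c e) (hx : ∀ e, 0 < x e) (e : Fin m) : x e ≤ lyap c q x := by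
  have h1 : c e * x e ≤ ∑ e, c e * x e :=
    Finset.single_le_sum (f := fun e => c e * x e) (fun e _ => by
      have := hx e; have := hc1 e; positivity) (Finset.mem_univ e)
  have h2 := energy_nonneg hc1 hx (q x)
  have := hc1 e; have := hx e
  simp only [lyap]
  nlinarith

lemma lyap_rate {n m : ℕ} {A : Matrix (Fin n) (Fin m) ℝ} {b : Fin n → ℝ} {c : Fin m → ℝ}
    {q : (Fin m → ℝ) → Fin m → ℝ} (hq : MinQ A b c q) (hc1 : ∀ e, 1 ≤ c e)
    {f0 : Fin m → ℝ} (hf0 : A.mulVec f0 = b) {x : ℝ → Fin m → ℝ}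
    (hx : ∀ t ∈ Ici (0:ℝ), (∀ e, 0 < x t e) ∧
      HasDerivWithinAt x (fun e => |q (x t) e| - x t e) (Ici 0) t) :
    ∃ C : ℝ, ∀ t, 0 < t → t * (lyap c q (x t) - 2 * costVec c f0) ≤ C := by
  set G : ℝ → ℝ := fun t => ∑ e, (2 * c e * |f0 e| * Real.log (x t e) - 2 * c e * x t e) with hG
  refine ⟨∑ e, 2 * c e * |f0 e| * lyap c q (x 0) - G 0, fun t ht => ?_⟩
  have hGd : ∀ s ∈ Ici (0:ℝ), HasDerivWithinAt G
      (∑ e, (2 * c e * |f0 e| * ((|q (x s) e| - x s e) / x s e)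
        - 2 * c e * (|q (x s) e| - x s e))) (Ici 0) s := fun s hs => by
    refine HasDerivWithinAt.fun_sum fun e _ => ?_
    have := hasDerivWithinAt_pi.1 (hx s hs).2 e
    exact ((this.log ((hx s hs).1 e).ne').const_mul _).sub (this.const_mul _)
  have hGge : ∀ s ∈ Ici (0:ℝ), lyap c q (x s) - 2 * costVec c f0 ≤
      ∑ e, (2 * c e * |f0 e| * ((|q (x s) e| - x s e) / x s e)
        - 2 * c e * (|q (x s) e| - x s e)) := fun s hs => by
    have hpos := (hx s hs).1
    have o := minQ_orth hq hc1 hpos hf0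
    have key : lyap c q (x s) - 2 * costVec c f0 + 2 * ∑ e, c e / x s e * q (x s) e * (f0 e - q (x s) e)
        ≤ ∑ e, (2 * c e * |f0 e| * ((|q (x s) e| - x s e) / x s e)
        - 2 * c e * (|q (x s) e| - x s e)) := by
      simp only [lyap, energy, costVec, Finset.mul_sum, ← Finset.sum_add_distrib,
        ← Finset.sum_sub_distrib]
      refine Finset.sum_le_sum fun e _ => ?_
      have h1 := hpos e
      have h2 := hc1 e
      rw [← sub_nonneg]
      have e1 : 2 * c e * |f0 e| * ((|q (x s) e| - x s e) / x s e) - 2 * c e * (|q (x s) e| - x s e)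
        - (c e * x s e + c e / x s e * q (x s) e ^ 2 - 2 * (c e * |f0 e|)
          + 2 * (c e / x s e * q (x s) e * (f0 e - q (x s) e)))
        = c e / x s e * (2 * (|f0 e| * |q (x s) e| - f0 e * q (x s) e)
          + (|q (x s) e| - x s e) ^ 2 + (q (x s) e ^ 2 - |q (x s) e| ^ 2)) := by
        field_simp; ring
      rw [e1, sq_abs, sub_self, add_zero]
      have h3 : f0 e * q (x s) e ≤ |f0 e| * |q (x s) e| := by
        rw [← abs_mul]; exact le_abs_self _
      have h4 : 0 ≤ 2 * (|f0 e| * |q (x s) e| - f0 e * q (x s) e) := by linarith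
      positivity
    rw [o] at key; linarith
  set D := lyap c q (x t) - 2 * costVec c f0 with hD
  have hGc : ContinuousOn G (Icc 0 t) :=
    (HasDerivWithinAt.continuousOn hGd).mono fun u hu => hu.1
  have hle : D * t ≤ G t - G 0 := by
    have := image_le_of_deriv_right_le_deriv_boundary (f := fun s => D * s) (f' := fun _ => D)
      (a := 0) (b := t) (by fun_prop)
      (fun u _ => by simpa using ((hasDerivAt_id u).const_mul D).hasDerivWithinAt)
      (B := fun s => G s - G 0) (by simp) (hGc.sub continuousOn_const)
      (fun u hu => ((hGd u hu.1).mono (Ici_subset_Ici.2 hu.1)).sub_const _)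
      (fun u hu => by
        refine le_trans ?_ (hGge u hu.1)
        have := lyap_anti hq hc1 hf0 hx hu.1 hu.2.le
        rw [hD]; linarith) (right_mem_Icc.2 ht.le)
    exact this
  have hGt : G t ≤ ∑ e, 2 * c e * |f0 e| * lyap c q (x 0) := by
    refine Finset.sum_le_sum fun e _ => ?_
    have hp := (hx t ht.le).1 e
    have h1 : Real.log (x t e) ≤ lyap c q (x 0) :=
      (Real.log_le_self hp.le).trans ((le_lyap hc1 (hx t ht.le).1 e).trans
        (lyap_anti hq hc1 hf0 hx le_rfl ht.le))
    have h2 := hc1 e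
    have h3 : 2 * c e * |f0 e| * Real.log (x t e) ≤ 2 * c e * |f0 e| * lyap c q (x 0) := by gcongr
    have : 0 ≤ 2 * c e * x t e := by positivity
    linarith
  linarith

lemma conv {n m : ℕ} {A : Matrix (Fin n) (Fin m) ℝ} {b : Fin n → ℝ} {c : Fin m → ℝ}
    {q : (Fin m → ℝ) → Fin m → ℝ} (hq : MinQ A b c q) (hc1 : ∀ e, 1 ≤ c e)
    {f0 : Fin m → ℝ} (hf0 : A.mulVec f0 = b)
    (hopt : ∀ f, A.mulVec f = b → costVec c f0 ≤ costVec c f)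
    (huniq : ∀ f, A.mulVec f = b → costVec c f = costVec c f0 → f = f0)
    {x : ℝ → Fin m → ℝ}
    (hx : ∀ t ∈ Ici (0:ℝ), (∀ e, 0 < x t e) ∧
      HasDerivWithinAt x (fun e => |q (x t) e| - x t e) (Ici 0) t) :
    Tendsto (fun t => fun e => |q (x t) e|) atTop (nhds fun e => |f0 e|) ∧
    Tendsto x atTop (nhds fun e => |f0 e|) := by
  obtain ⟨C, hC⟩ := lyap_rate hq hc1 hf0 hx
  set O := costVec c f0 with hO
  have hge : ∀ t ∈ Ici (0:ℝ), ∀ e, 2 * O ≤ 2 * costVec c (q (x t)) ∧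
      2 * costVec c (q (x t)) ≤ lyap c q (x t) ∧
      c e * (|q (x t) e| - x t e) ^ 2 / x t e ≤ lyap c q (x t) - 2 * O := fun t ht e => by
    have hp := (hx t ht).1
    have h1 := hopt _ (hq _ hp).1
    have h2 := lyap_eq (c := c) (q := q) hp
    have h3 : ∀ e ∈ Finset.univ, 0 ≤ c e * (|q (x t) e| - x t e) ^ 2 / x t e := fun e _ => by
      have := hp e; have := hc1 e; positivity
    have h4 := Finset.sum_nonneg h3
    have h5 := Finset.single_le_sum h3 (Finset.mem_univ e)
    exact ⟨by linarith, by linarith, by linarith⟩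
  have hge2 : ∀ t ∈ Ici (0:ℝ), 2 * O ≤ 2 * costVec c (q (x t)) ∧
      2 * costVec c (q (x t)) ≤ lyap c q (x t) := fun t ht => by
    have hp := (hx t ht).1
    have h1 := hopt _ (hq _ hp).1
    have h2 := lyap_eq (c := c) (q := q) hp
    have h3 : ∀ e ∈ Finset.univ, 0 ≤ c e * (|q (x t) e| - x t e) ^ 2 / x t e := fun e _ => by
      have := hp e; have := hc1 e; positivity
    have h4 := Finset.sum_nonneg h3
    exact ⟨by linarith, by linarith⟩
  have hV : Tendsto (fun t => lyap c q (x t)) atTop (nhds (2 * O)) := by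
    have hu : Tendsto (fun t : ℝ => 2 * O + C / t) atTop (nhds (2 * O)) := by
      have h : Tendsto (fun t : ℝ => C / t) atTop (nhds 0) :=
        tendsto_const_nhds.div_atTop tendsto_id
      simpa using h.const_add (2 * O)
    refine tendsto_of_tendsto_of_tendsto_of_le_of_le' tendsto_const_nhds hu ?_ ?_
    · filter_upwards [eventually_ge_atTop 0] with t ht
      exact (hge2 t ht).1.trans (hge2 t ht).2
    · filter_upwards [eventually_gt_atTop 0] with t ht
      have := hC t ht
      have : lyap c q (x t) - 2 * O ≤ C / t := by rw [le_div_iff₀ ht]; linarith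
      linarith
  have hcost : Tendsto (fun t => costVec c (q (x t))) atTop (nhds O) := by
    have hV2 : Tendsto (fun t => lyap c q (x t) / 2) atTop (nhds O) := by
      simpa using hV.div_const 2
    refine tendsto_of_tendsto_of_tendsto_of_le_of_le' tendsto_const_nhds hV2 ?_ ?_
    · filter_upwards [eventually_ge_atTop 0] with t ht
      linarith [hge2 t ht]
    · filter_upwards [eventually_ge_atTop 0] with t ht
      linarith [hge2 t ht]
  set V0 := lyap c q (x 0) with hV0
  have hVb : ∀ t ∈ Ici (0:ℝ), lyap c q (x t) ≤ V0 := fun t ht => lyap_anti hq hc1 hf0 hx le_rfl ht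
  have hccont : Continuous (costVec c) := by unfold costVec; fun_prop
  have hqb : ∀ t ∈ Ici (0:ℝ), q (x t) ∈ Metric.closedBall (0 : Fin m → ℝ) (|V0|) := fun t ht => by
    rw [mem_closedBall_zero_iff, pi_norm_le_iff_of_nonneg (abs_nonneg _)]
    intro e
    have h1 : c e * |q (x t) e| ≤ costVec c (q (x t)) :=
      Finset.single_le_sum (f := fun e => c e * |q (x t) e|) (fun e _ => by
        have := hc1 e; positivity) (Finset.mem_univ e)
    have h2 := hVb t ht
    have h3 := (hge2 t ht).2
    have h4 := hc1 e
    have h5 := abs_nonneg (q (x t) e)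
    rw [Real.norm_eq_abs]
    refine le_trans ?_ (le_abs_self V0)
    nlinarith
  have hqt : Tendsto (fun t => q (x t)) atTop (nhds f0) := by
    refine (isCompact_closedBall (0 : Fin m → ℝ) |V0|).tendsto_nhds_of_unique_mapClusterPt ?_ ?_
    · filter_upwards [eventually_ge_atTop 0] with t ht using hqb t ht
    · intro g _ hg
      refine huniq g ?_ ?_
      · have hcl : IsClosed {f : Fin m → ℝ | A.mulVec f = b} :=
          isClosed_eq (by fun_prop) continuous_const
        refine hcl.mem_of_mapClusterPt hg ?_
        filter_upwards [eventually_ge_atTop 0] with t ht using (hq _ (hx t ht).1).1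
      · have h1 : MapClusterPt (costVec c g) atTop (fun t => costVec c (q (x t))) :=
          hg.continuousAt_comp hccont.continuousAt
        have h2 : ClusterPt (costVec c g) (nhds O) := ClusterPt.mono h1 hcost
        have : (nhds (costVec c g) ⊓ nhds O).NeBot := h2
        exact eq_of_nhds_neBot this
  have hqa : Tendsto (fun t => fun e => |q (x t) e|) atTop (nhds fun e => |f0 e|) :=
    tendsto_pi_nhds.2 fun e => (tendsto_pi_nhds.1 hqt e).abs
  refine ⟨hqa, tendsto_pi_nhds.2 fun e => ?_⟩
  have hdiff : Tendsto (fun t => (|q (x t) e| - x t e) ^ 2) atTop (nhds 0) := by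
    have hu : Tendsto (fun t => |V0| * (lyap c q (x t) - 2 * O)) atTop (nhds 0) := by
      simpa using (hV.sub_const (2 * O)).const_mul |V0|
    refine tendsto_of_tendsto_of_tendsto_of_le_of_le' tendsto_const_nhds hu ?_ ?_
    · exact Eventually.of_forall fun t => sq_nonneg _
    · filter_upwards [eventually_ge_atTop 0] with t ht
      have hp := (hx t ht).1 e
      have h1 := (hge t ht e).2.2
      have h2 : x t e ≤ |V0| :=
        ((le_lyap hc1 (hx t ht).1 e).trans (hVb t ht)).trans (le_abs_self _)
      rw [div_le_iff₀ hp] at h1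
      have h3 := hc1 e
      have h4 : 0 ≤ lyap c q (x t) - 2 * O := by linarith [hge2 t ht]
      nlinarith [sq_nonneg (|q (x t) e| - x t e)]
  have hd2 : Tendsto (fun t => |q (x t) e| - x t e) atTop (nhds 0) := by
    have := hdiff.sqrt
    simp only [Real.sqrt_sq_eq_abs, Real.sqrt_zero] at this
    exact (tendsto_zero_iff_abs_tendsto_zero _).2 this
  have := (tendsto_pi_nhds.1 hqa e).sub hd2
  simpa using this

lemma bfs_of_indep {n m : ℕ} {A : Matrix (Fin n) (Fin m) ℝ} {b : Fin n → ℝ}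
    (hrank : A.rank = n) {f : Fin m → ℝ} (hf : A.mulVec f = b)
    (hli : LinearIndepOn ℝ A.col {e | f e ≠ 0}) : IsBFS A b f := by
  classical
  obtain ⟨S, -, hS, hspan, hSli⟩ := exists_linearIndepOn_extension hli (subset_univ _)
  have hsp : Submodule.span ℝ (range fun i : S => A.col i) = Submodule.span ℝ (range A.col) := by
    apply le_antisymm
    · refine Submodule.span_mono ?_
      rintro _ ⟨i, rfl⟩; exact ⟨i, rfl⟩
    · rw [Submodule.span_le]
      rintro _ ⟨i, rfl⟩
      have := hspan ⟨i, mem_univ _, rfl⟩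
      rwa [image_eq_range] at this
  have hcard : Fintype.card S = n := by
    have h1 := finrank_span_eq_card (show LinearIndependent ℝ (fun i : S => A.col i) from hSli)
    rw [hsp, ← Matrix.rank_eq_finrank_span_cols, hrank] at h1
    exact h1.symm
  set eqv := (Fintype.equivFinOfCardEq hcard).symm with heqv
  set B : Fin n → Fin m := fun i => (eqv i : Fin m) with hB
  have hBinj : Function.Injective B := Subtype.val_injective.comp eqv.injective
  have hrange : ∀ e, (∀ i, B i ≠ e) → f e = 0 := fun e he => by
    by_contra h
    have : e ∈ S := hS h
    exact he (eqv.symm ⟨e, this⟩) (by simp [hB])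
  have hu : IsUnit (A.submatrix id B).det := by
    rw [← Matrix.isUnit_iff_isUnit_det, ← Matrix.linearIndependent_cols_iff_isUnit]
    exact (show LinearIndependent ℝ (fun i : S => A.col i) from hSli).comp eqv eqv.injective
  refine ⟨hf, B, hBinj, hu, ?_, hrange⟩
  have hAB : (A.submatrix id B).mulVec (fun i => f (B i)) = b := by
    rw [← hf]
    funext i
    simp only [Matrix.mulVec, dotProduct, Matrix.submatrix_apply, id]
    refine Fintype.sum_of_injective B hBinj _ _ (fun e he => ?_) (fun _ => rfl)
    rw [hrange e fun i hi => he ⟨i, hi⟩, mul_zero]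
  intro i
  rw [← hAB, Matrix.mulVec_mulVec, Matrix.nonsing_inv_mul _ hu, Matrix.one_mulVec]

lemma abs_add_sub {a f : ℝ} (h : |a| ≤ |f|) : |f + a| + |f - a| = 2 * |f| := by
  grind

lemma opt_unique {n m : ℕ} {A : Matrix (Fin n) (Fin m) ℝ} {b : Fin n → ℝ} {c : Fin m → ℝ}
    (hc1 : ∀ e, 1 ≤ c e) (hrank : A.rank = n)
    (hdistinct : ∀ f g : Fin m → ℝ, IsBFS A b f → IsBFS A b g → f ≠ g →
      costVec c f ≠ costVec c g)
    {f0 : Fin m → ℝ} (hf0 : A.mulVec f0 = b)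
    (hopt : ∀ f, A.mulVec f = b → costVec c f0 ≤ costVec c f)
    {f : Fin m → ℝ} (hf : A.mulVec f = b) (hcf : costVec c f = costVec c f0) : f = f0 := by
  set O := costVec c f0 with hO
  set F : Set (Fin m → ℝ) := {g | A.mulVec g = b ∧ costVec c g = O} with hF
  have hccont : Continuous (costVec c) := by unfold costVec; fun_prop
  have hclosed : IsClosed F :=
    (isClosed_eq (by fun_prop) continuous_const).inter (isClosed_eq hccont continuous_const)
  have hcomp : IsCompact F := by
    refine (isCompact_closedBall (0 : Fin m → ℝ) |O|).of_isClosed_subset hclosed fun g hg => ?_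
    rw [mem_closedBall_zero_iff, pi_norm_le_iff_of_nonneg (abs_nonneg _)]
    intro e
    have h1 : c e * |g e| ≤ costVec c g :=
      Finset.single_le_sum (f := fun e => c e * |g e|) (fun e _ => by
        have := hc1 e; positivity) (Finset.mem_univ e)
    rw [hg.2] at h1
    have h4 := hc1 e
    have h5 := abs_nonneg (g e)
    rw [Real.norm_eq_abs]
    refine le_trans ?_ (le_abs_self O)
    nlinarith
  have hconv : Convex ℝ F := by
    intro g hg h hh s t hs ht hst
    have hA : A.mulVec (s • g + t • h) = b := by
      rw [Matrix.mulVec_add, Matrix.mulVec_smul, Matrix.mulVec_smul, hg.1, hh.1, ← add_smul, hst,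
        one_smul]
    refine ⟨hA, le_antisymm ?_ (hopt _ hA)⟩
    have : costVec c (s • g + t • h) ≤ s * costVec c g + t * costVec c h := by
      simp only [costVec, Finset.mul_sum, ← Finset.sum_add_distrib]
      refine Finset.sum_le_sum fun e _ => ?_
      have h1 : |(s • g + t • h) e| ≤ s * |g e| + t * |h e| := by
        simp only [Pi.add_apply, Pi.smul_apply, smul_eq_mul]
        refine (abs_add_le _ _).trans ?_
        rw [abs_mul, abs_mul, abs_of_nonneg hs, abs_of_nonneg ht]
      nlinarith [hc1 e]
    rw [hg.2, hh.2, ← add_mul, hst, one_mul] at this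
    exact this
  have hext : ∀ p ∈ F.extremePoints ℝ, IsBFS A b p := by
    intro p hp
    rw [mem_extremePoints] at hp
    obtain ⟨hpF, hpe⟩ := hp
    refine bfs_of_indep hrank hpF.1 ?_
    have hset : {e | p e ≠ 0} = ((Finset.univ.filter fun e => p e ≠ 0 : Finset (Fin m)) : Set (Fin m)) := by
      ext; simp
    rw [hset, linearIndepOn_finset_iff]
    intro g hg e he
    set g' : Fin m → ℝ := fun e => if p e ≠ 0 then g e else 0 with hg'
    have hAg : A.mulVec g' = 0 := by
      rw [← hg]
      funext i
      simp only [Matrix.mulVec, dotProduct, Finset.sum_apply, Pi.smul_apply, smul_eq_mul,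
        Matrix.col_apply, Finset.sum_filter, hg']
      refine Finset.sum_congr rfl fun e _ => ?_
      split_ifs <;> ring
    obtain ⟨ε, hε0, hε⟩ : ∃ ε > 0, ∀ e, |ε * g' e| ≤ |p e| := by
      have : ∀ᶠ ε in nhdsWithin (0:ℝ) (Ioi 0), ∀ e, |ε * g' e| ≤ |p e| := by
        refine eventually_all.2 fun e => ?_
        by_cases hpe : p e = 0
        · refine Eventually.of_forall fun ε => ?_
          simp [hg', hpe]
        · refine eventually_nhdsWithin_of_eventually_nhds ?_
          have hc : ContinuousAt (fun ε : ℝ => |ε * g' e|) 0 := by fun_prop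
          have : (fun ε : ℝ => |ε * g' e|) 0 < |p e| := by simpa using hpe
          exact (hc.eventually_lt_const this).mono fun _ h => h.le
      exact (this.and self_mem_nhdsWithin).exists.imp fun a h => ⟨h.2, h.1⟩
    have hA1 : A.mulVec (p + ε • g') = b := by
      rw [Matrix.mulVec_add, Matrix.mulVec_smul, hAg, hpF.1]; simp
    have hA2 : A.mulVec (p - ε • g') = b := by
      rw [Matrix.mulVec_sub, Matrix.mulVec_smul, hAg, hpF.1]; simp
    have hsum : costVec c (p + ε • g') + costVec c (p - ε • g') = 2 * costVec c p := by
      simp only [costVec, Finset.mul_sum, ← Finset.sum_add_distrib]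
      refine Finset.sum_congr rfl fun e _ => ?_
      have := abs_add_sub (hε e)
      simp only [Pi.add_apply, Pi.sub_apply, Pi.smul_apply, smul_eq_mul]
      rw [← mul_add, this]; ring
    have h1 := hopt _ hA1
    have h2 := hopt _ hA2
    rw [hpF.2] at hsum
    have hm1 : p + ε • g' ∈ F := ⟨hA1, by linarith⟩
    have hm2 : p - ε • g' ∈ F := ⟨hA2, by linarith⟩
    have hseg : p ∈ openSegment ℝ (p + ε • g') (p - ε • g') := by
      refine ⟨1/2, 1/2, by norm_num, by norm_num, by norm_num, ?_⟩
      module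
    have h3 := (hpe _ hm1 _ hm2 hseg).1
    have h4 : ε * g' e = 0 := by
      have := congrFun h3 e
      simpa using this
    have h5 : g' e = 0 := (mul_eq_zero.1 h4).resolve_left hε0.ne'
    have hpe : p e ≠ 0 := by simpa using he
    simpa [hg', hpe] using h5
  have hKM := closure_convexHull_extremePoints hcomp hconv
  have hfF : f ∈ F := ⟨hf, hcf⟩
  have hf0F : f0 ∈ F := ⟨hf0, rfl⟩
  have hne : (F.extremePoints ℝ).Nonempty := hcomp.extremePoints_nonempty ⟨f, hfF⟩
  obtain ⟨p, hp⟩ := hne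
  have hsub : F.extremePoints ℝ ⊆ {p} := fun r hr => by
    by_contra hrp
    refine hdistinct r p (hext r hr) (hext p hp) hrp ?_
    rw [(extremePoints_subset hr).2, (extremePoints_subset hp).2]
  have hFp : F ⊆ {p} := by
    rw [← hKM]
    refine closure_minimal (convexHull_min hsub (convex_singleton p)) isClosed_singleton
  rw [hFp hfF, hFp hf0F]

/-- The uniform Physarum dynamics `ẋ = |q(x)| − x` with positive start
has a unique solution on `[0,∞)`, which stays positive and converges (together with
`|q(x(t))|`) to the optimum `x*` of the weighted basis pursuit problem. -/
theorem uniform_physarum_converges_to_optimum {n m : ℕ} (hnm : n ≤ m)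
    (A : Matrix (Fin n) (Fin m) ℝ) (b : Fin n → ℝ) (c : Fin m → ℝ)
    (hAZ : ∀ i j, ∃ z : ℤ, A i j = (z : ℝ))
    (hbZ : ∀ i, ∃ z : ℤ, b i = (z : ℝ))
    (hcZ : ∀ e, ∃ z : ℤ, c e = (z : ℝ))
    (hc1 : ∀ e, 1 ≤ c e)
    (hrank : A.rank = n)
    (hfeas : ∃ f : Fin m → ℝ, A.mulVec f = b)
    (hdistinct : ∀ f g : Fin m → ℝ, IsBFS A b f → IsBFS A b g → f ≠ g →
      costVec c f ≠ costVec c g)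
    (xstar : Fin m → ℝ)
    (hopt : ∃ fstar : Fin m → ℝ, A.mulVec fstar = b ∧ (∀ e, |fstar e| ≤ xstar e) ∧
      ∀ (f y : Fin m → ℝ), A.mulVec f = b → (∀ e, |f e| ≤ y e) →
        ∑ e, c e * xstar e ≤ ∑ e, c e * y e)
    (q : (Fin m → ℝ) → Fin m → ℝ)
    (hq : ∀ x : Fin m → ℝ, (∀ e, 0 < x e) →
      A.mulVec (q x) = b ∧
      ∀ f : Fin m → ℝ, A.mulVec f = b → energy c x (q x) ≤ energy c x f)
    (x₀ : Fin m → ℝ) (hx₀ : ∀ e, 0 < x₀ e) :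
    ∃ x : ℝ → Fin m → ℝ,
      (x 0 = x₀ ∧ (∀ t ∈ Set.Ici (0 : ℝ), ∀ e, 0 < x t e) ∧
        ∀ t ∈ Set.Ici (0 : ℝ), ∀ e, HasDerivWithinAt (fun s => x s e)
          (|q (x t) e| - x t e) (Set.Ici 0) t) ∧
      (∀ y : ℝ → Fin m → ℝ,
        (y 0 = x₀ ∧ (∀ t ∈ Set.Ici (0 : ℝ), ∀ e, 0 < y t e) ∧
          ∀ t ∈ Set.Ici (0 : ℝ), ∀ e, HasDerivWithinAt (fun s => y s e)
            (|q (y t) e| - y t e) (Set.Ici 0) t) →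
        ∀ t ∈ Set.Ici (0 : ℝ), y t = x t) ∧
      Tendsto x atTop (nhds xstar) ∧
      Tendsto (fun t => fun e => |q (x t) e|) atTop (nhds xstar) := by
  obtain ⟨f0, hf0, hle, hmin⟩ := hopt
  have hopt' : ∀ f, A.mulVec f = b → costVec c f0 ≤ costVec c f := fun f hf => by
    refine le_trans ?_ (hmin f (fun e => |f e|) hf fun e => le_rfl)
    exact Finset.sum_le_sum fun e _ => mul_le_mul_of_nonneg_left (hle e) (by linarith [hc1 e])
  have hxs : xstar = fun e => |f0 e| := by
    funext e
    have h1 := hmin f0 (fun e => |f0 e|) hf0 fun e => le_rfl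
    have h2 : ∀ e ∈ Finset.univ, c e * |f0 e| ≤ c e * xstar e := fun e _ =>
      mul_le_mul_of_nonneg_left (hle e) (by linarith [hc1 e])
    have h3 := (Finset.sum_eq_sum_iff_of_le h2).1 (le_antisymm (Finset.sum_le_sum h2) h1) e
      (Finset.mem_univ e)
    exact (mul_left_cancel₀ (by linarith [hc1 e] : c e ≠ 0) h3).symm
  have hq' : MinQ A b c q := hq
  obtain ⟨x, hx0, hx⟩ := exists_sol hq' hc1 hf0 hx₀
  obtain ⟨l1, l2⟩ := conv hq' hc1 hf0 hopt'
    (fun f hf hcf => opt_unique hc1 hrank hdistinct hf0 hopt' hf hcf) hx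
  rw [← hxs] at l1 l2
  refine ⟨x, ⟨hx0, fun t ht => (hx t ht).1, fun t ht e => hasDerivWithinAt_pi.1 (hx t ht).2 e⟩,
    ?_, l2, l1⟩
  rintro y ⟨hy0, hypos, hyd⟩ t ht
  refine sol_unique hq' hc1 hf0 (T := t) (hy0.trans hx0.symm) (fun s hs => ⟨hypos s hs.1, ?_⟩)
    (fun s hs => ⟨(hx s hs.1).1, (hx s hs.1).2.mono fun u hu => hu.1⟩) ⟨ht, le_rfl⟩
  exact (hasDerivWithinAt_pi.2 fun e => hyd s hs.1 e).mono fun u hu => hu.1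
end

section
/- Let x : [0,∞) → ℝ be differentiable with x(0) = 1/2 and ẋ(t) = (e^{−t}/2)·(1 − x(t)) for all t ≥ 0. Then 1/2 ≤ x(t) ≤ 3/4 for all t ≥ 0; in particular x(t) does not converge to 1 as t → ∞. -/
open Filter

/-- The solution of `ẋ = (e^{−t}/2)(1 − x)` with `x(0) = 1/2` stays in
`[1/2, 3/4]` and hence does not converge to `1`. This shows that the lower bound
`a_e(x,t) ≥ ε > 0` on the reactivities is necessary for convergence of the
non-uniform Physarum dynamics. -/
theorem vanishing_reactivity_counterexample (x : ℝ → ℝ)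
    (hx0 : x 0 = 1 / 2)
    (hdyn : ∀ t ∈ Set.Ici (0 : ℝ),
      HasDerivWithinAt x (Real.exp (-t) / 2 * (1 - x t)) (Set.Ici 0) t) :
    (∀ t ∈ Set.Ici (0 : ℝ), 1 / 2 ≤ x t ∧ x t ≤ 3 / 4) ∧
    ¬ Tendsto x atTop (nhds 1) := by
  have hg : ∀ t ∈ Set.Ici (0 : ℝ),
      HasDerivWithinAt (fun s => (1 - x s) * Real.exp (-(Real.exp (-s) / 2))) 0 (Set.Ici 0) t := by
    intro t ht
    have h1 : HasDerivAt (fun s : ℝ => Real.exp (-(Real.exp (-s) / 2)))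
        (Real.exp (-(Real.exp (-t) / 2)) * (-(Real.exp (-t) * (-1) / 2))) t :=
      ((((hasDerivAt_id t).neg).exp.div_const 2).neg).exp
    have h2 := ((hdyn t ht).const_sub 1).mul h1.hasDerivWithinAt
    refine h2.congr_deriv ?_
    ring
  have key : ∀ t ∈ Set.Ici (0 : ℝ),
      1 - x t = 1 / 2 * Real.exp (Real.exp (-t) / 2 - 1 / 2) := by
    intro t ht
    have h := constant_of_has_deriv_right_zero (a := 0) (b := t)
      (fun s hs => ((hg s hs.1).continuousWithinAt).mono Set.Icc_subset_Ici_self)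
      (fun s hs => (hg s hs.1).mono (Set.Ici_subset_Ici.2 hs.1)) t ⟨ht, le_rfl⟩
    simp only [hx0, neg_zero, Real.exp_zero] at h
    rw [Real.exp_neg, ← div_eq_mul_inv, div_eq_iff (Real.exp_pos _).ne'] at h
    rw [h, mul_assoc, ← Real.exp_add]
    ring_nf
  have hb : ∀ t ∈ Set.Ici (0 : ℝ), 1 / 2 ≤ x t ∧ x t ≤ 3 / 4 := by
    intro t ht
    have h := key t ht
    have h1 : Real.exp (-t) ≤ 1 := Real.exp_le_one_iff.2 (neg_nonpos.2 ht)
    have h2 : Real.exp (Real.exp (-t) / 2 - 1 / 2) ≤ 1 := Real.exp_le_one_iff.2 (by linarith)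
    have h3 := Real.add_one_le_exp (Real.exp (-t) / 2 - 1 / 2)
    have h4 := Real.exp_pos (-t)
    constructor <;> linarith
  refine ⟨hb, fun hl => ?_⟩
  have := le_of_tendsto hl ((eventually_ge_atTop (0 : ℝ)).mono fun t ht => (hb t ht).2)
  norm_num at this
end

section
/- For each e ∈ [m] let g_e : ℝ_{≥0} → ℝ_{≥0} be a strictly increasing differentiable function with g_e(1) = 1, and let x : [0,∞) → ℝ^m be a solution of the refined Physarum dynamics with x_e(t) > 0 for all e and t. Then the function L(t) = E_{x(t)}(q(x(t))) + cᵀx(t) = ∑_e (c_e/x_e(t)) q_e(x(t))² + ∑_e c_e x_e(t) is nonincreasing in t; moreover, its derivative at time t is 0 if and only if |q_e(x(t))| = x_e(t) for every e, i.e., if and only if x(t) is a fixed point of the dynamics. -/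
open Matrix Filter Set

theorem aux_sandwich {u F v : ℝ → ℝ} {d t : ℝ} {S : Set ℝ} (ht : t ∈ S)
    (hu : HasDerivWithinAt u d S t) (hv : HasDerivWithinAt v d S t)
    (h1 : ∀ s ∈ S, u s ≤ F s) (h2 : ∀ s ∈ S, F s ≤ v s) (h3 : u t = v t) :
    HasDerivWithinAt F d S t := by
  have hF1 := h1 t ht
  have hF2 := h2 t ht
  have h0 : HasDerivWithinAt (fun s => v s - u s) 0 S t := by
    simpa using hv.fun_sub hu
  have hG : HasDerivWithinAt (fun s => F s - u s) 0 S t := by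
    rw [hasDerivWithinAt_iff_isLittleO] at h0 ⊢
    refine Asymptotics.IsBigO.trans_isLittleO (Asymptotics.IsBigO.of_bound 1 ?_) h0
    filter_upwards [self_mem_nhdsWithin] with s hs
    have := h1 s hs
    have := h2 s hs
    have e1 : F t - u t = 0 := by linarith
    have e2 : v t - u t = 0 := by linarith
    simp only [smul_zero, e1, e2, sub_zero, one_mul, Real.norm_eq_abs]
    rw [abs_of_nonneg (by linarith), abs_of_nonneg (by linarith)]
    linarith
  have := hG.fun_add hu
  simpa using this

theorem aux_quad {a B : ℝ} (hB : 0 ≤ B) (h : ∀ s : ℝ, 0 ≤ 2 * s * a + s ^ 2 * B) : a = 0 := by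
  by_contra ha
  have h1 := h (-a / (B + 1))
  have hB1 : 0 < B + 1 := by linarith
  have e : 2 * (-a / (B + 1)) * a + (-a / (B + 1)) ^ 2 * B
      = -(a ^ 2 * (B + 2)) / (B + 1) ^ 2 := by
    field_simp
    ring
  rw [e] at h1
  have : 0 < a ^ 2 * (B + 2) / (B + 1) ^ 2 := by positivity
  rw [neg_div] at h1
  linarith

theorem aux_orth {n m : ℕ} (A : Matrix (Fin n) (Fin m) ℝ) (b : Fin n → ℝ) (c x q : Fin m → ℝ)
    (hc : ∀ e, 1 ≤ c e) (hx : ∀ e, 0 < x e) (hqb : A.mulVec q = b)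
    (hmin : ∀ f : Fin m → ℝ, A.mulVec f = b → energy c x q ≤ energy c x f)
    (f : Fin m → ℝ) (hf : A.mulVec f = b) :
    ∑ e, c e / x e * q e * f e = energy c x q := by
  have key : ∑ e, c e / x e * q e * (f e - q e) = 0 := by
    apply aux_quad (B := ∑ e, c e / x e * (f e - q e) ^ 2)
    · refine Finset.sum_nonneg fun e _ => ?_
      have := hx e
      have : 0 < c e := by linarith [hc e]
      positivity
    · intro s
      have h := hmin (q + s • (f - q)) (by
        rw [Matrix.mulVec_add, Matrix.mulVec_smul, Matrix.mulVec_sub, hf, hqb]; simp)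
      have e : energy c x (q + s • (f - q)) = energy c x q
          + (2 * s * ∑ e, c e / x e * q e * (f e - q e)
            + s ^ 2 * ∑ e, c e / x e * (f e - q e) ^ 2) := by
        unfold energy
        rw [Finset.mul_sum, Finset.mul_sum, ← Finset.sum_add_distrib, ← Finset.sum_add_distrib]
        refine Finset.sum_congr rfl fun e _ => ?_
        simp only [Pi.add_apply, Pi.smul_apply, Pi.sub_apply, smul_eq_mul]
        ring
      linarith
  have : ∑ e, c e / x e * q e * f e
      = ∑ e, c e / x e * q e * (f e - q e) + energy c x q := by
    unfold energy
    rw [← Finset.sum_add_distrib]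
    exact Finset.sum_congr rfl fun e _ => by ring
  rw [this, key, zero_add]

theorem aux_term {g : ℝ → ℝ} (hg : StrictMonoOn g (Set.Ici (0 : ℝ))) (hg1 : g 1 = 1)
    {c x q : ℝ} (hc : 1 ≤ c) (hx : 0 < x) :
    c * (x * (g (|q| / x) - 1)) * (1 - q ^ 2 / x ^ 2) ≤ 0 ∧
    (c * (x * (g (|q| / x) - 1)) * (1 - q ^ 2 / x ^ 2) = 0 ↔ |q| = x) := by
  have e : q ^ 2 / x ^ 2 = (|q| / x) ^ 2 := by rw [div_pow, sq_abs]
  have e' : |q| = x ↔ |q| / x = 1 := by rw [div_eq_one_iff_eq hx.ne']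
  have hr : 0 ≤ |q| / x := by positivity
  rw [e, e']
  generalize |q| / x = r at *
  have hcx : 0 < c * x := mul_pos (by linarith) hx
  have e3 : c * (x * (g r - 1)) * (1 - r ^ 2) = -(c * x * ((g r - 1) * (r ^ 2 - 1))) := by ring
  rw [e3]
  rcases lt_trichotomy r 1 with h | h | h
  · have h1 := hg (Set.mem_Ici.2 hr) (Set.mem_Ici.2 zero_le_one) h
    rw [hg1] at h1
    have : 0 < (g r - 1) * (r ^ 2 - 1) := mul_pos_of_neg_of_neg (by linarith) (by nlinarith)
    have := mul_pos hcx this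
    exact ⟨by linarith, fun h => by linarith, fun h' => by linarith⟩
  · subst h
    simp
  · have h1 := hg (Set.mem_Ici.2 zero_le_one) (Set.mem_Ici.2 hr) h
    rw [hg1] at h1
    have : 0 < (g r - 1) * (r ^ 2 - 1) := mul_pos (by linarith) (by nlinarith)
    have := mul_pos hcx this
    exact ⟨by linarith, fun h => by linarith, fun h' => by linarith⟩

/-- `L(t) = E_{x(t)}(q(x(t))) + cᵀx(t)` is a Lyapunov function for the
refined Physarum dynamics: it is nonincreasing, and its derivative vanishes at time
`t` iff `|q_e(x(t))| = x_e(t)` for every `e`, i.e. iff `x(t)` is a fixed point. -/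
theorem refined_physarum_lyapunov {n m : ℕ} (hnm : n ≤ m)
    (A : Matrix (Fin n) (Fin m) ℝ) (b : Fin n → ℝ) (c : Fin m → ℝ)
    (hAZ : ∀ i j, ∃ z : ℤ, A i j = (z : ℝ))
    (hbZ : ∀ i, ∃ z : ℤ, b i = (z : ℝ))
    (hcZ : ∀ e, ∃ z : ℤ, c e = (z : ℝ))
    (hc1 : ∀ e, 1 ≤ c e)
    (hrank : A.rank = n)
    (hfeas : ∃ f : Fin m → ℝ, A.mulVec f = b)
    (q : (Fin m → ℝ) → Fin m → ℝ)
    (hq : ∀ x : Fin m → ℝ, (∀ e, 0 < x e) →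
      A.mulVec (q x) = b ∧
      ∀ f : Fin m → ℝ, A.mulVec f = b → energy c x (q x) ≤ energy c x f)
    (g : Fin m → ℝ → ℝ)
    (hg0 : ∀ e, ∀ y ∈ Set.Ici (0 : ℝ), 0 ≤ g e y)
    (hgmono : ∀ e, StrictMonoOn (g e) (Set.Ici (0 : ℝ)))
    (hgdiff : ∀ e, DifferentiableOn ℝ (g e) (Set.Ici (0 : ℝ)))
    (hg1 : ∀ e, g e 1 = 1)
    (x : ℝ → Fin m → ℝ)
    (hpos : ∀ t ∈ Set.Ici (0 : ℝ), ∀ e, 0 < x t e)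
    (hdyn : ∀ t ∈ Set.Ici (0 : ℝ), ∀ e, HasDerivWithinAt (fun s => x s e)
      (x t e * (g e (|q (x t) e| / x t e) - 1)) (Set.Ici 0) t) :
    AntitoneOn (fun t => energy c (x t) (q (x t)) + ∑ e, c e * x t e)
      (Set.Ici (0 : ℝ)) ∧
    ∀ t ∈ Set.Ici (0 : ℝ), ∃ L' : ℝ,
      HasDerivWithinAt (fun s => energy c (x s) (q (x s)) + ∑ e, c e * x s e)
        L' (Set.Ici 0) t ∧ L' ≤ 0 ∧
      (L' = 0 ↔ ∀ e, |q (x t) e| = x t e) := by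
  have main : ∀ t ∈ Set.Ici (0 : ℝ), ∃ L' : ℝ,
      HasDerivWithinAt (fun s => energy c (x s) (q (x s)) + ∑ e, c e * x s e)
        L' (Set.Ici 0) t ∧ L' ≤ 0 ∧
      (L' = 0 ↔ ∀ e, |q (x t) e| = x t e) := by
    intro t ht
    have hxt := hpos t ht
    obtain ⟨hqb, hmin⟩ := hq (x t) hxt
    set d : Fin m → ℝ := fun e => x t e * (g e (|q (x t) e| / x t e) - 1) with hd
    have hterm := fun e => aux_term (hgmono e) (hg1 e) (q := q (x t) e) (hc1 e) (hxt e)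
    have hE : HasDerivWithinAt (fun s => energy c (x s) (q (x s)))
        (∑ e, -(c e * d e * (q (x t) e ^ 2 / x t e ^ 2))) (Set.Ici 0) t := by
      apply aux_sandwich ht
        (u := fun s => 2 * energy c (x t) (q (x t))
          - ∑ e, x s e * (c e * (q (x t) e ^ 2 / x t e ^ 2)))
        (v := fun s => ∑ e, c e / x s e * q (x t) e ^ 2)
      · have h1 : HasDerivWithinAt (fun s => ∑ e, x s e * (c e * (q (x t) e ^ 2 / x t e ^ 2)))
            (∑ e, d e * (c e * (q (x t) e ^ 2 / x t e ^ 2))) (Set.Ici 0) t :=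
          HasDerivWithinAt.fun_sum fun e _ => (hdyn t ht e).mul_const _
        have h2 := h1.const_sub (2 * energy c (x t) (q (x t)))
        refine h2.congr_deriv ?_
        rw [← Finset.sum_neg_distrib]
        exact Finset.sum_congr rfl fun e _ => by ring
      · refine HasDerivWithinAt.fun_sum fun e _ => ?_
        have h1 := (((hasDerivWithinAt_const t (Set.Ici (0 : ℝ)) (c e)).fun_div
          (hdyn t ht e) (hxt e).ne').mul_const (q (x t) e ^ 2))
        refine h1.congr_deriv ?_
        simp only [hd]
        ring
      · intro s hs
        have hxs := hpos s hs
        have ho := aux_orth A b c (x t) (q (x t)) hc1 hxt hqb hmin (q (x s)) (hq (x s) hxs).1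
        rw [← ho]
        unfold energy
        rw [Finset.mul_sum, ← Finset.sum_sub_distrib]
        refine Finset.sum_le_sum fun e _ => ?_
        have p1 := hxs e
        have p2 := hxt e
        have p3 : 0 < c e := by linarith [hc1 e]
        have : c e / x s e * q (x s) e ^ 2 - (2 * (c e / x t e * q (x t) e * q (x s) e)
            - x s e * (c e * (q (x t) e ^ 2 / x t e ^ 2)))
            = c e / x s e * (q (x s) e - x s e * q (x t) e / x t e) ^ 2 := by
          field_simp
          ring
        have : 0 ≤ c e / x s e * (q (x s) e - x s e * q (x t) e / x t e) ^ 2 := by positivity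
        linarith
      · intro s hs
        exact (hq (x s) (hpos s hs)).2 _ hqb
      · have : ∑ e, x t e * (c e * (q (x t) e ^ 2 / x t e ^ 2)) = energy c (x t) (q (x t)) := by
          unfold energy
          refine Finset.sum_congr rfl fun e _ => ?_
          have p2 := hxt e
          field_simp
        change 2 * energy c (x t) (q (x t)) - _ = energy c (x t) (q (x t))
        rw [this]
        ring
    have hC : HasDerivWithinAt (fun s => ∑ e, c e * x s e) (∑ e, c e * d e) (Set.Ici 0) t :=
      HasDerivWithinAt.fun_sum fun e _ => (hdyn t ht e).const_mul _
    refine ⟨∑ e, c e * d e * (1 - q (x t) e ^ 2 / x t e ^ 2), ?_, ?_, ?_⟩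
    · refine (hE.fun_add hC).congr_deriv ?_
      rw [← Finset.sum_add_distrib]
      exact Finset.sum_congr rfl fun e _ => by ring
    · exact Finset.sum_nonpos fun e _ => (hterm e).1
    · rw [Finset.sum_eq_zero_iff_of_nonpos fun e _ => (hterm e).1]
      exact ⟨fun h e => (hterm e).2.1 (h e (Finset.mem_univ e)),
        fun h e _ => (hterm e).2.2 (h e)⟩
  refine ⟨?_, main⟩
  choose! L' h1 h2 h3 using main
  refine antitoneOn_of_hasDerivWithinAt_nonpos (f' := L') (convex_Ici 0)
    (fun t ht => (h1 t ht).continuousWithinAt)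
    (fun t ht => (h1 t (interior_subset ht)).mono interior_subset)
    (fun t ht => h2 t (interior_subset ht))
end

section
/- Assume that any two distinct basic feasible solutions of Af = b have distinct cost. For each e ∈ [m] let g_e : ℝ_{≥0} → ℝ_{≥0} be a strictly increasing differentiable function with g_e(1) = 1, and let x : [0,∞) → ℝ^m be the solution of the refined Physarum dynamics with x(0) > 0. Then there is a basic feasible solution f of Af = b such that, as t → ∞, x(t) → |f|, |q(x(t))| → |f|, and both E_{x(t)}(q(x(t))) and cᵀx(t) converge to cᵀ|f|. -/
open Matrix Filter Set

lemma squeeze_hasDeriv {f lo hi : ℝ → ℝ} {s : Set ℝ} {t d : ℝ}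
    (hlo : HasDerivWithinAt lo d s t) (hhi : HasDerivWithinAt hi d s t)
    (h1 : ∀ z ∈ s, lo z ≤ f z) (h2 : ∀ z ∈ s, f z ≤ hi z)
    (e1 : lo t = f t) (e2 : hi t = f t) : HasDerivWithinAt f d s t := by
  rw [hasDerivWithinAt_iff_isLittleO] at *
  rw [Asymptotics.isLittleO_iff] at *
  intro ε hε
  filter_upwards [hlo hε, hhi hε, self_mem_nhdsWithin] with z hz1 hz2 hzs
  have a1 := h1 z hzs
  have a2 := h2 z hzs
  rw [Real.norm_eq_abs, abs_le] at hz1 hz2 ⊢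
  rw [e1] at hz1
  rw [e2] at hz2
  constructor <;> linarith [hz1.1, hz1.2, hz2.1, hz2.2]

lemma ph_orth {n m : ℕ} {A : Matrix (Fin n) (Fin m) ℝ} {b : Fin n → ℝ} {c x q : Fin m → ℝ}
    (hA : A.mulVec q = b)
    (hmin : ∀ f : Fin m → ℝ, A.mulVec f = b → energy c x q ≤ energy c x f)
    (h : Fin m → ℝ) (hh : A.mulVec h = 0) : ∑ e, c e / x e * q e * h e = 0 := by
  set S := ∑ e, c e / x e * q e * h e with hS
  set T := ∑ e, c e / x e * h e ^ 2 with hT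
  have key : ∀ r : ℝ, 0 ≤ 2 * r * S + r ^ 2 * T := by
    intro r
    have h1 := hmin (q + r • h) (by rw [Matrix.mulVec_add, Matrix.mulVec_smul, hh, hA]; simp)
    have h2 : energy c x (q + r • h) = energy c x q + (2 * r * S + r ^ 2 * T) := by
      unfold energy
      rw [hS, hT, Finset.mul_sum, Finset.mul_sum, ← Finset.sum_add_distrib,
        ← Finset.sum_add_distrib]
      refine Finset.sum_congr rfl fun e _ => ?_
      simp only [Pi.add_apply, Pi.smul_apply, smul_eq_mul]
      ring
    linarith
  by_contra hne
  have hT0 : 0 < T ^ 2 + 1 := by positivity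
  have k1 := key (-S / (T ^ 2 + 1))
  have k2 : 2 * (-S / (T ^ 2 + 1)) * S + (-S / (T ^ 2 + 1)) ^ 2 * T
      = S ^ 2 * (T - 2 * (T ^ 2 + 1)) / (T ^ 2 + 1) ^ 2 := by
    field_simp
    ring
  rw [k2] at k1
  have hS2 : 0 < S ^ 2 := by positivity
  have : S ^ 2 * (T - 2 * (T ^ 2 + 1)) / (T ^ 2 + 1) ^ 2 < 0 := by
    apply div_neg_of_neg_of_pos _ (by positivity)
    apply mul_neg_of_pos_of_neg hS2
    nlinarith [sq_nonneg (T - 1), sq_nonneg T]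
  linarith

lemma ph_lower {n m : ℕ} {A : Matrix (Fin n) (Fin m) ℝ} {b : Fin n → ℝ} {c x x' q : Fin m → ℝ}
    (hc : ∀ e, 0 < c e) (hx : ∀ e, 0 < x e) (hx' : ∀ e, 0 < x' e)
    (hA : A.mulVec q = b)
    (hmin : ∀ f : Fin m → ℝ, A.mulVec f = b → energy c x q ≤ energy c x f)
    (f : Fin m → ℝ) (hf : A.mulVec f = b) :
    2 * energy c x q - ∑ e, c e * x' e * (q e / x e) ^ 2 ≤ energy c x' f := by
  have ho := ph_orth hA hmin (f - q) (by rw [Matrix.mulVec_sub, hf, hA]; simp)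
  have h1 : ∑ e, c e / x e * q e * f e = energy c x q := by
    unfold energy
    rw [← sub_eq_zero, ← ho, ← Finset.sum_sub_distrib]
    refine Finset.sum_congr rfl fun e _ => ?_
    simp only [Pi.sub_apply]; ring
  rw [← h1]
  unfold energy
  rw [Finset.mul_sum, ← Finset.sum_sub_distrib]
  refine Finset.sum_le_sum fun e _ => ?_
  have := hc e; have := hx e; have := hx' e
  have h2 : c e / x' e * f e ^ 2 - (2 * (c e / x e * q e * f e) - c e * x' e * (q e / x e) ^ 2)
    = c e / x' e * (f e - x' e * (q e / x e)) ^ 2 := by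
    field_simp
    ring
  have : 0 ≤ c e / x' e * (f e - x' e * (q e / x e)) ^ 2 := by positivity
  linarith

/-- derivative of the energy along a curve -/
lemma ph_energy_deriv {n m : ℕ} {A : Matrix (Fin n) (Fin m) ℝ} {b : Fin n → ℝ} {c : Fin m → ℝ}
    (hc : ∀ e, 0 < c e) (q : (Fin m → ℝ) → Fin m → ℝ)
    (hq : ∀ x : Fin m → ℝ, (∀ e, 0 < x e) →
      A.mulVec (q x) = b ∧
      ∀ f : Fin m → ℝ, A.mulVec f = b → energy c x (q x) ≤ energy c x f)
    (x : ℝ → Fin m → ℝ) (v : Fin m → ℝ) (s : Set ℝ) (hpos : ∀ t ∈ s, ∀ e, 0 < x t e)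
    (t : ℝ) (ht : t ∈ s)
    (hd : ∀ e, HasDerivWithinAt (fun s => x s e) (v e) s t) :
    HasDerivWithinAt (fun r => energy c (x r) (q (x r)))
      (- ∑ e, c e * v e * (q (x t) e / x t e) ^ 2) s t := by
  have hxt := hpos t ht
  apply squeeze_hasDeriv (s := s)
    (lo := fun r => 2 * energy c (x t) (q (x t)) - ∑ e, c e * x r e * (q (x t) e / x t e) ^ 2)
    (hi := fun r => energy c (x r) (q (x t)))
  · have : HasDerivWithinAt (fun r => ∑ e, c e * x r e * (q (x t) e / x t e) ^ 2)
      (∑ e, c e * v e * (q (x t) e / x t e) ^ 2) s t :=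
      HasDerivWithinAt.fun_sum fun e _ => ((hd e).const_mul _).mul_const _
    exact this.const_sub _
  · unfold energy
    have : HasDerivWithinAt (fun r => ∑ e, c e / x r e * (q (x t) e) ^ 2)
      (∑ e, (0 * x t e - c e * v e) / x t e ^ 2 * (q (x t) e) ^ 2) s t :=
      HasDerivWithinAt.fun_sum fun e _ =>
        ((hasDerivWithinAt_const t s (c e)).div (hd e) (hxt e).ne').mul_const _
    convert this using 1
    rw [← Finset.sum_neg_distrib]
    refine Finset.sum_congr rfl fun e _ => ?_
    have := (hxt e).ne'
    field_simp
    ring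
  · intro z hz
    exact ph_lower hc hxt (hpos z hz) (hq _ hxt).1 (hq _ hxt).2 _ (hq _ (hpos z hz)).1
  · intro z hz
    exact (hq _ (hpos z hz)).2 _ (hq _ hxt).1
  · unfold energy
    have : ∑ e, c e * x t e * (q (x t) e / x t e) ^ 2 = ∑ e, c e / x t e * (q (x t) e) ^ 2 := by
      refine Finset.sum_congr rfl fun e _ => ?_
      have := (hxt e).ne'
      field_simp
    simp only [this]; ring
  · rfl

lemma ph_psi (a z₀ : ℝ) : HasDerivAt (fun z : ℝ => (max (z - a) 0) ^ 2) (2 * max (z₀ - a) 0) z₀ := by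
  rw [← hasDerivWithinAt_univ]
  apply squeeze_hasDeriv
    (lo := fun z => 2 * max (z₀ - a) 0 * (z - z₀) + (max (z₀ - a) 0) ^ 2)
    (hi := fun z => 2 * max (z₀ - a) 0 * (z - z₀) + (max (z₀ - a) 0) ^ 2 + (z - z₀) ^ 2)
  · have := ((((hasDerivAt_id z₀).sub_const z₀).const_mul (2 * max (z₀ - a) 0)).add_const
      ((max (z₀ - a) 0) ^ 2)).hasDerivWithinAt (s := Set.univ)
    simpa using this
  · have := (((((hasDerivAt_id z₀).sub_const z₀).const_mul (2 * max (z₀ - a) 0)).add_const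
      ((max (z₀ - a) 0) ^ 2)).add (((hasDerivAt_id z₀).sub_const z₀).pow 2)).hasDerivWithinAt (s := Set.univ)
    simpa [Pi.add_def] using this
  · intro z _
    rcases max_cases (z₀ - a) 0 with ⟨h1, h2⟩ | ⟨h1, h2⟩ <;>
    rcases max_cases (z - a) 0 with ⟨h3, h4⟩ | ⟨h3, h4⟩ <;> simp only [h1, h3] <;> nlinarith [sq_nonneg (z - z₀), sq_nonneg (z - a), sq_nonneg (z₀ - a)]
  · intro z _
    rcases max_cases (z₀ - a) 0 with ⟨h1, h2⟩ | ⟨h1, h2⟩ <;>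
    rcases max_cases (z - a) 0 with ⟨h3, h4⟩ | ⟨h3, h4⟩ <;> simp only [h1, h3] <;> nlinarith [sq_nonneg (z - z₀), sq_nonneg (z - a), sq_nonneg (z₀ - a)]
  · simp
  · simp

lemma ph_bfs_of_indep {n m : ℕ} {A : Matrix (Fin n) (Fin m) ℝ} {b : Fin n → ℝ}
    (hrank : A.rank = n) {f : Fin m → ℝ} (hf : A.mulVec f = b)
    (hind : ∀ h : Fin m → ℝ, A.mulVec h = 0 → (∀ e, f e = 0 → h e = 0) → h = 0) :
    IsBFS A b f := by
  classical
  set S : Set (Fin m) := {e | f e ≠ 0} with hS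
  have hli : LinearIndepOn ℝ A.col S := by
    rw [linearIndepOn_iff']
    intro t g hts h0 i hit
    have h1 := hind (fun e => if e ∈ t then g e else 0) (by
      rw [Matrix.mulVec_eq_sum]
      rw [← h0]
      rw [← Finset.sum_subset (Finset.subset_univ t)]
      · refine Finset.sum_congr rfl fun e he => ?_
        simp [he]
        rfl
      · intro e _ he
        simp [he]) (by
      intro e he
      by_cases het : e ∈ t
      · exact absurd he (hts het)
      · simp [het])
    have := congrFun h1 i
    simpa [hit] using this
  set B := hli.extend (Set.subset_univ S) with hB
  have hBli : LinearIndepOn ℝ A.col B := hli.linearIndepOn_extend _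
  have hSB : S ⊆ B := hli.subset_extend _
  have hspan := hli.span_image_extend_eq_span_image (Set.subset_univ S)
  have hcard : Fintype.card B = n := by
    have h1 := finrank_span_eq_card hBli
    rw [Matrix.rank_eq_finrank_span_cols] at hrank
    rw [← h1]
    refine Eq.trans ?_ hrank
    rw [Set.image_univ] at hspan
    rw [← hspan, Set.image_eq_range]
  let φ : Fin n ≃ B := (Fintype.equivFinOfCardEq hcard).symm
  have hinj : Function.Injective (fun i => (φ i : Fin m)) :=
    Subtype.val_injective.comp φ.injective
  have hU : IsUnit (A.submatrix id (fun i => (φ i : Fin m))) := by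
    rw [← Matrix.linearIndependent_cols_iff_isUnit]
    have := hBli.linearIndependent.comp φ φ.injective
    exact this
  have hdet := (Matrix.isUnit_iff_isUnit_det _).1 hU
  have hout : ∀ e, (∀ i, (φ i : Fin m) ≠ e) → f e = 0 := by
    intro e he
    by_contra hne
    have heB : e ∈ B := hSB hne
    exact he (φ.symm ⟨e, heB⟩) (by simp)
  refine ⟨hf, fun i => (φ i : Fin m), hinj, hdet, ?_, hout⟩
  have hmul : (A.submatrix id (fun i => (φ i : Fin m))).mulVec (fun i => f (φ i)) = b := by
    rw [← hf]
    ext j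
    simp only [Matrix.mulVec, dotProduct, Matrix.submatrix_apply, id]
    refine Finset.sum_of_injOn (fun i => (φ i : Fin m)) hinj.injOn (by simp) ?_ (by simp)
    intro e _ he
    rw [hout e, mul_zero]
    intro i hi
    exact he ⟨i, by simp, hi⟩
  intro i
  rw [← hmul, Matrix.mulVec_mulVec, Matrix.nonsing_inv_mul _ hdet, Matrix.one_mulVec]

lemma ph_move {m : ℕ} {f h : Fin m → ℝ} (hsupp : ∀ e, f e = 0 → h e = 0)
    (hneg : ∃ e, f e * h e < 0) :
    ∃ t : ℝ, 0 < t ∧ SignCompat (f + t • h) f ∧ ∃ e, f e ≠ 0 ∧ (f + t • h) e = 0 := by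
  classical
  obtain ⟨e₀, he₀⟩ := hneg
  obtain ⟨e₁, h1, h2⟩ := Finset.exists_min_image (Finset.univ.filter fun e => f e * h e < 0)
    (fun e => - f e / h e) ⟨e₀, by simp [he₀]⟩
  simp only [Finset.mem_filter, Finset.mem_univ, true_and] at h1 h2
  have key : ∀ e, f e * h e < 0 → 0 < - f e / h e := by
    intro e he
    have hne : h e ≠ 0 := by rintro h0; simp [h0] at he
    have : - f e / h e = - (f e * h e) / (h e) ^ 2 := by field_simp
    rw [this]
    have : 0 < h e ^ 2 := by positivity
    exact div_pos (by linarith) this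
  have hne1 : h e₁ ≠ 0 := by rintro h0; simp [h0] at h1
  have hnf1 : f e₁ ≠ 0 := by rintro h0; simp [h0] at h1
  set t := - f e₁ / h e₁ with ht
  have htpos := key e₁ h1
  refine ⟨t, htpos, ?_, e₁, hnf1, ?_⟩
  · intro e he
    simp only [Pi.add_apply, Pi.smul_apply, smul_eq_mul] at he ⊢
    have hfe : f e ≠ 0 := by
      intro h0
      exact he (by simp [h0, hsupp e h0])
    have hsq : 0 < f e ^ 2 := by positivity
    have hnn : 0 ≤ (f e + t * h e) * f e := by
      rcases lt_or_ge (f e * h e) 0 with hlt | hge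
      · have h3 := h2 e hlt
        have hhe : h e ≠ 0 := by rintro h0; simp [h0] at hlt
        have h4 : (- f e / h e) * (f e * h e) = - f e ^ 2 := by field_simp
        nlinarith
      · nlinarith
    exact lt_of_le_of_ne hnn (mul_ne_zero he hfe).symm
  · simp only [Pi.add_apply, Pi.smul_apply, smul_eq_mul, ht]
    field_simp
    ring

lemma ph_sgn {s f f' : ℝ} (h : s * f = |f|) (h' : f' ≠ 0 → 0 < f' * f) : s * f' = |f'| := by
  by_cases h0 : f' = 0
  · simp [h0]
  have hp := h' h0
  rcases pos_and_pos_or_neg_and_neg_of_mul_pos hp with ⟨a, b⟩ | ⟨a, b⟩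
  · rw [abs_of_pos b] at h
    have : s = 1 := mul_right_cancel₀ b.ne' (by linarith)
    rw [abs_of_pos a, this, one_mul]
  · rw [abs_of_neg b] at h
    have : s = -1 := mul_right_cancel₀ b.ne (by linarith)
    rw [abs_of_neg a, this]; ring

lemma ph_bfs_of_tight {n m : ℕ} {A : Matrix (Fin n) (Fin m) ℝ} {b : Fin n → ℝ} {c : Fin m → ℝ}
    (hc : ∀ e, 0 < c e) (hrank : A.rank = n)
    (hdistinct : ∀ f g : Fin m → ℝ, IsBFS A b f → IsBFS A b g → f ≠ g →
      costVec c f ≠ costVec c g) (s : Fin m → ℝ) :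
    ∀ (N : ℕ) (f : Fin m → ℝ), (Finset.univ.filter fun e => f e ≠ 0).card = N →
      A.mulVec f = b → (∀ e, s e * f e = |f e|) →
      (∀ h : Fin m → ℝ, A.mulVec h = 0 → (∀ e, f e = 0 → h e = 0) →
        ∑ e, c e * s e * h e = 0) → IsBFS A b f := by
  classical
  intro N
  induction N using Nat.strong_induction_on with
  | _ N ih =>
  intro f hN hf hs horth
  apply ph_bfs_of_indep hrank hf
  by_contra hcon
  push Not at hcon
  obtain ⟨h, hA, hsupp, hne⟩ := hcon
  have hneg : ∀ h : Fin m → ℝ, A.mulVec h = 0 → (∀ e, f e = 0 → h e = 0) → h ≠ 0 →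
      ∃ e, f e * h e < 0 := by
    intro h hA hsupp hne
    by_contra hall
    push Not at hall
    apply hne
    have h1 : ∀ e, s e * h e = |h e| := by
      intro e
      apply ph_sgn (hs e)
      intro h0
      have h2 : f e ≠ 0 := fun h3 => h0 (hsupp e h3)
      rw [mul_comm]
      exact lt_of_le_of_ne (hall e) (mul_ne_zero h2 h0).symm
    have h2 := horth h hA hsupp
    have h3 : ∀ e, c e * s e * h e = c e * |h e| := by
      intro e; rw [mul_assoc, h1]
    simp only [h3] at h2
    rw [Finset.sum_eq_zero_iff_of_nonneg
      (fun e _ => mul_nonneg (hc e).le (abs_nonneg _))] at h2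
    ext e
    have := h2 e (Finset.mem_univ e)
    simpa [(hc e).ne'] using this
  have step : ∀ h : Fin m → ℝ, A.mulVec h = 0 → (∀ e, f e = 0 → h e = 0) → h ≠ 0 →
      ∃ t : ℝ, 0 < t ∧ IsBFS A b (f + t • h) ∧ costVec c (f + t • h) = costVec c f := by
    intro h hA hsupp hne
    obtain ⟨t, ht, hsc, e₁, he1, he2⟩ := ph_move hsupp (hneg h hA hsupp hne)
    have hs' : ∀ e, s e * (f + t • h) e = |(f + t • h) e| :=
      fun e => ph_sgn (hs e) (hsc e)
    have hz : ∀ e, f e = 0 → (f + t • h) e = 0 := by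
      intro e he
      simp [he, hsupp e he]
    refine ⟨t, ht, ih _ ?_ (f + t • h) rfl ?_ hs' ?_, ?_⟩
    · rw [← hN]
      apply Finset.card_lt_card
      rw [Finset.ssubset_iff_of_subset]
      · exact ⟨e₁, by simp [he1], by simpa using he2⟩
      · intro e he
        simp only [Finset.mem_filter, Finset.mem_univ, true_and] at he ⊢
        exact fun h0 => he (hz e h0)
    · rw [Matrix.mulVec_add, Matrix.mulVec_smul, hA, hf]; simp
    · intro k hk hks
      exact horth k hk fun e he => hks e (hz e he)
    · unfold costVec
      have h0 := horth h hA hsupp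
      have : ∀ e, c e * |(f + t • h) e| = c e * |f e| + t * (c e * s e * h e) := by
        intro e
        rw [← hs' e, ← hs e]
        simp only [Pi.add_apply, Pi.smul_apply, smul_eq_mul]
        ring
      simp only [this, Finset.sum_add_distrib, ← Finset.mul_sum, h0]
      ring
  obtain ⟨t, ht, hb1, hc1⟩ := step h hA hsupp hne
  obtain ⟨t', ht', hb2, hc2⟩ := step (-h) (by rw [Matrix.mulVec_neg, hA, neg_zero])
    (fun e he => by simp [hsupp e he]) (neg_ne_zero.2 hne)
  refine hdistinct _ _ hb1 hb2 ?_ (hc1.trans hc2.symm)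
  intro heq
  apply hne
  ext e
  have := congrFun heq e
  simp only [Pi.add_apply, Pi.smul_apply, smul_eq_mul, Pi.neg_apply] at this
  have h5 : (t + t') * h e = 0 := by linarith
  rcases mul_eq_zero.1 h5 with h6 | h6
  · linarith
  · exact h6

/-- characterization of the minimum energy solution at the boundary -/
def PhOpt {n m : ℕ} (A : Matrix (Fin n) (Fin m) ℝ) (b : Fin n → ℝ) (c x q : Fin m → ℝ) : Prop :=
  A.mulVec q = b ∧ (∀ e, x e = 0 → q e = 0) ∧
    ∀ h : Fin m → ℝ, A.mulVec h = 0 → (∀ e, x e = 0 → h e = 0) →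
      ∑ e, c e / x e * q e * h e = 0

lemma ph_opt_unique {n m : ℕ} {A : Matrix (Fin n) (Fin m) ℝ} {b : Fin n → ℝ}
    {c x q q' : Fin m → ℝ} (hc : ∀ e, 0 < c e) (hx : ∀ e, 0 ≤ x e)
    (h1 : PhOpt A b c x q) (h2 : PhOpt A b c x q') : q = q' := by
  have hk : A.mulVec (q - q') = 0 := by rw [Matrix.mulVec_sub, h1.1, h2.1, sub_self]
  have hs : ∀ e, x e = 0 → (q - q') e = 0 := by
    intro e he; simp [h1.2.1 e he, h2.2.1 e he]
  have o1 := h1.2.2 _ hk hs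
  have o2 := h2.2.2 _ hk hs
  have o3 : ∑ e, c e / x e * ((q - q') e) ^ 2 = 0 := by
    rw [← sub_self (0 : ℝ)]
    nth_rewrite 1 [← o1]
    rw [← o2, ← Finset.sum_sub_distrib]
    refine Finset.sum_congr rfl fun e _ => ?_
    simp only [Pi.sub_apply]; ring
  rw [Finset.sum_eq_zero_iff_of_nonneg
    (fun e _ => mul_nonneg (div_nonneg (hc e).le (hx e)) (sq_nonneg _))] at o3
  ext e
  by_cases he : x e = 0
  · rw [h1.2.1 e he, h2.2.1 e he]
  · have := o3 e (Finset.mem_univ e)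
    have h4 : (q - q') e = 0 := by simpa [(hc e).ne', he] using this
    simpa [sub_eq_zero] using h4

lemma ph_limit {n m : ℕ} {A : Matrix (Fin n) (Fin m) ℝ} {b : Fin n → ℝ} {c : Fin m → ℝ}
    (q : (Fin m → ℝ) → Fin m → ℝ)
    (hq : ∀ x : Fin m → ℝ, (∀ e, 0 < x e) →
      A.mulVec (q x) = b ∧
      ∀ f : Fin m → ℝ, A.mulVec f = b → energy c x (q x) ≤ energy c x f)
    (C : ℝ) (l : Ultrafilter ℝ) (X : ℝ → Fin m → ℝ)
    (hpos : ∀ᶠ i in (l : Filter ℝ), ∀ e, 0 < X i e)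
    (hE : ∀ᶠ i in (l : Filter ℝ), ∀ e, (q (X i) e) ^ 2 ≤ C * X i e)
    (x' : Fin m → ℝ) (hX : Tendsto X l (nhds x')) :
    ∃ q', Tendsto (fun i => q (X i)) l (nhds q') ∧ PhOpt A b c x' q' ∧
      Tendsto (fun i => energy c (X i) (q (X i))) l (nhds (energy c x' q')) := by
  have hXe : ∀ e, Tendsto (fun i => X i e) l (nhds (x' e)) := fun e => tendsto_pi_nhds.1 hX e
  have hbd : ∀ᶠ i in (l : Filter ℝ), ∀ e, C * X i e ≤ C * x' e + 1 := by
    rw [eventually_all]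
    intro e
    have h1 : Tendsto (fun i => C * X i e) l (nhds (C * x' e)) := (hXe e).const_mul C
    filter_upwards [h1.eventually (gt_mem_nhds (lt_add_one (C * x' e)))] with i hi using hi.le
  have hmem : ∀ᶠ i in (l : Filter ℝ), q (X i) ∈
      Set.Icc (fun e => -(C * x' e + 2)) (fun e => C * x' e + 2) := by
    filter_upwards [hE, hbd] with i h1 h2
    have : ∀ e, |q (X i) e| ≤ C * x' e + 2 := by
      intro e
      have a1 := h1 e
      have a2 := h2 e
      nlinarith [sq_abs (q (X i) e), sq_nonneg (|q (X i) e| - 1), abs_nonneg (q (X i) e)]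
    exact ⟨fun e => (abs_le.1 (this e)).1, fun e => (abs_le.1 (this e)).2⟩
  obtain ⟨q', -, hq'⟩ := (isCompact_Icc (a := fun e => -(C * x' e + 2))
    (b := fun e => C * x' e + 2)).ultrafilter_le_nhds (l.map fun i => q (X i))
      (by rw [Filter.le_principal_iff]; exact hmem)
  have hQ : Tendsto (fun i => q (X i)) l (nhds q') := hq'
  have hQe : ∀ e, Tendsto (fun i => q (X i) e) l (nhds (q' e)) := fun e => tendsto_pi_nhds.1 hQ e
  have hfeas : A.mulVec q' = b := by
    have h1 : Tendsto (fun i => A.mulVec (q (X i))) l (nhds (A.mulVec q')) :=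
      ((Continuous.matrix_mulVec continuous_const continuous_id).tendsto q').comp hQ
    have h2 : Tendsto (fun i => A.mulVec (q (X i))) l (nhds b) := by
      apply tendsto_const_nhds.congr'
      filter_upwards [hpos] with i hi using (hq _ hi).1.symm
    exact tendsto_nhds_unique h1 h2
  have hzero : ∀ e, x' e = 0 → q' e = 0 := by
    intro e he
    have h1 : (q' e) ^ 2 ≤ C * x' e := by
      apply le_of_tendsto_of_tendsto ((hQe e).pow 2) ((hXe e).const_mul C)
      filter_upwards [hE] with i hi using hi e
    rw [he, mul_zero] at h1
    exact pow_eq_zero_iff (two_ne_zero) |>.1 (le_antisymm h1 (sq_nonneg _))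
  have hlim : ∀ h : Fin m → ℝ, (∀ e, x' e = 0 → h e = 0) →
      Tendsto (fun i => ∑ e, c e / X i e * q (X i) e * h e) l
        (nhds (∑ e, c e / x' e * q' e * h e)) := by
    intro h hh
    apply tendsto_finsetSum
    intro e _
    by_cases he : x' e = 0
    · simp [hh e he]
    · exact ((tendsto_const_nhds.div (hXe e) he).mul (hQe e)).mul_const _
  refine ⟨q', hQ, ⟨hfeas, hzero, ?_⟩, ?_⟩
  · intro h hA hh
    refine tendsto_nhds_unique (hlim h hh) (tendsto_const_nhds.congr' ?_)
    filter_upwards [hpos] with i hi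
    exact (ph_orth (hq _ hi).1 (hq _ hi).2 h hA).symm
  · have h1 := hlim q' hzero
    have h2 : ∑ e, c e / x' e * q' e * q' e = energy c x' q' := by
      unfold energy
      refine Finset.sum_congr rfl fun e _ => ?_
      ring
    rw [h2] at h1
    refine h1.congr' ?_
    filter_upwards [hpos] with i hi
    have h3 := ph_orth (hq _ hi).1 (hq _ hi).2 (q (X i) - q')
      (by rw [Matrix.mulVec_sub, hfeas, (hq _ hi).1, sub_self])
    unfold energy
    rw [eq_comm, ← sub_eq_zero, ← h3, ← Finset.sum_sub_distrib]
    refine Finset.sum_congr rfl fun e _ => ?_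
    simp only [Pi.sub_apply]; ring

lemma ph_unifcont {z u : ℝ → ℝ} {g : ℝ → ℝ} {M C : ℝ}
    (hg0 : ∀ y ∈ Set.Ici (0 : ℝ), 0 ≤ g y) (hgm : MonotoneOn g (Set.Ici (0 : ℝ)))
    (hz : ∀ t ∈ Set.Ici (0 : ℝ), 0 < z t) (hzM : ∀ t ∈ Set.Ici (0 : ℝ), z t ≤ M)
    (hu : ∀ t ∈ Set.Ici (0 : ℝ), 0 ≤ u t) (hC : ∀ t ∈ Set.Ici (0 : ℝ), z t * u t ^ 2 ≤ C)
    (hd : ∀ t ∈ Set.Ici (0 : ℝ),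
      HasDerivWithinAt z (z t * (g (u t) - 1)) (Set.Ici 0) t)
    (η : ℝ) (hη : 0 < η) :
    ∃ τ > 0, ∀ s ∈ Set.Ici (0 : ℝ), ∀ t ∈ Set.Ici (0 : ℝ), |s - t| ≤ τ → |z s - z t| ≤ η := by
  have h00 : (0 : ℝ) ∈ Set.Ici (0 : ℝ) := by simp
  have hM : 0 < M := lt_of_lt_of_le (hz 0 h00) (hzM 0 h00)
  have hC0 : 0 ≤ C := le_trans (mul_nonneg (hz 0 h00).le (sq_nonneg _)) (hC 0 h00)
  set a := η / 2 with ha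
  have ha0 : 0 < a := by positivity
  set U := C / a + 1 with hU
  have hU0 : 0 ≤ U := by positivity
  set K := 2 * M * (M * (g U + 1)) + 1 with hK
  have hgU := hg0 U hU0
  have hK0 : 0 < K := by positivity
  set ψ : ℝ → ℝ := fun w => (max (w - a) 0) ^ 2 with hψ
  have hder : ∀ t ∈ Set.Ici (0 : ℝ), HasDerivWithinAt (fun t => ψ (z t))
      (2 * max (z t - a) 0 * (z t * (g (u t) - 1))) (Set.Ici 0) t := by
    intro t ht
    exact (ph_psi a (z t)).comp_hasDerivWithinAt t (hd t ht)
  have hbound : ∀ t ∈ Set.Ici (0 : ℝ), ‖2 * max (z t - a) 0 * (z t * (g (u t) - 1))‖ ≤ K := by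
    intro t ht
    have z0 := hz t ht
    have zM := hzM t ht
    rcases le_total (z t) a with hle | hle
    · rw [max_eq_right (by linarith)]; simpa using hK0.le
    · rw [max_eq_left (by linarith)]
      have huU : u t ≤ U := by
        by_contra hlt
        push Not at hlt
        have h1 := hC t ht
        have h2 : C / a * a = C := by field_simp
        have h3 : 0 ≤ C / a := by positivity
        have h4 : a * u t ^ 2 ≤ C := by nlinarith [sq_nonneg (u t)]
        have h5 : C / a + 1 < u t ^ 2 := by nlinarith
        nlinarith
      have hg1 : g (u t) ≤ g U := hgm (hu t ht) hU0 huU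
      have hg2 := hg0 (u t) (hu t ht)
      have h6 : |g (u t) - 1| ≤ g U + 1 := by rw [abs_le]; constructor <;> linarith
      rw [Real.norm_eq_abs, abs_mul, abs_mul, abs_mul, abs_of_pos z0,
        abs_of_nonneg (by linarith : 0 ≤ z t - a), abs_of_pos (by norm_num : (0:ℝ) < 2)]
      have h7 : 2 * (z t - a) * (z t * |g (u t) - 1|) ≤ 2 * M * (M * (g U + 1)) := by
        have : z t - a ≤ M := by linarith
        have : 0 ≤ z t - a := by linarith
        gcongr
      linarith
  have hlip : ∀ s ∈ Set.Ici (0 : ℝ), ∀ t ∈ Set.Ici (0 : ℝ),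
      |ψ (z s) - ψ (z t)| ≤ K * |s - t| := by
    intro s hs t ht
    exact (convex_Ici (0 : ℝ)).norm_image_sub_le_of_norm_hasDerivWithin_le hder hbound ht hs
  refine ⟨a ^ 2 / K, by positivity, ?_⟩
  intro s hs t ht hst
  have h1 := hlip s hs t ht
  have h2 : K * |s - t| ≤ a ^ 2 := by
    have : K * (a ^ 2 / K) = a ^ 2 := by field_simp
    nlinarith
  have h3 : |ψ (z s) - ψ (z t)| ≤ a ^ 2 := h1.trans h2
  simp only [hψ] at h3
  have zs := hz s hs
  have zt := hz t ht
  have hη2 : η = 2 * a := by rw [ha]; ring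
  rw [hη2]
  have p1 := le_max_left (z s - a) 0
  have p2 := le_max_right (z s - a) 0
  have p3 := le_max_left (z t - a) 0
  have p4 := le_max_right (z t - a) 0
  have p5 : max (z s - a) 0 ≤ z s := max_le (by linarith) zs.le
  have p6 : max (z t - a) 0 ≤ z t := max_le (by linarith) zt.le
  generalize max (z s - a) 0 = y at *
  generalize max (z t - a) 0 = w at *
  rw [abs_le] at h3
  have h4 : y - w ≤ a := by nlinarith [h3.1, h3.2]
  have h5 : w - y ≤ a := by nlinarith [h3.1, h3.2]
  rw [abs_le]
  constructor <;> linarith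
/-- Under distinct costs of basic feasible solutions, the solution of
the refined Physarum dynamics converges to `|f|` for some basic feasible solution
`f`, and so do `|q(x(t))|`, the energy, and the cost. -/
theorem refined_physarum_converges_to_fixed_point {n m : ℕ} (hnm : n ≤ m)
    (A : Matrix (Fin n) (Fin m) ℝ) (b : Fin n → ℝ) (c : Fin m → ℝ)
    (hAZ : ∀ i j, ∃ z : ℤ, A i j = (z : ℝ))
    (hbZ : ∀ i, ∃ z : ℤ, b i = (z : ℝ))
    (hcZ : ∀ e, ∃ z : ℤ, c e = (z : ℝ))
    (hc1 : ∀ e, 1 ≤ c e)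
    (hrank : A.rank = n)
    (hfeas : ∃ f : Fin m → ℝ, A.mulVec f = b)
    (hdistinct : ∀ f g : Fin m → ℝ, IsBFS A b f → IsBFS A b g → f ≠ g →
      costVec c f ≠ costVec c g)
    (q : (Fin m → ℝ) → Fin m → ℝ)
    (hq : ∀ x : Fin m → ℝ, (∀ e, 0 < x e) →
      A.mulVec (q x) = b ∧
      ∀ f : Fin m → ℝ, A.mulVec f = b → energy c x (q x) ≤ energy c x f)
    (g : Fin m → ℝ → ℝ)
    (hg0 : ∀ e, ∀ y ∈ Set.Ici (0 : ℝ), 0 ≤ g e y)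
    (hgmono : ∀ e, StrictMonoOn (g e) (Set.Ici (0 : ℝ)))
    (hgdiff : ∀ e, DifferentiableOn ℝ (g e) (Set.Ici (0 : ℝ)))
    (hg1 : ∀ e, g e 1 = 1)
    (x : ℝ → Fin m → ℝ) (hx₀ : ∀ e, 0 < x 0 e)
    (hpos : ∀ t ∈ Set.Ici (0 : ℝ), ∀ e, 0 < x t e)
    (hdyn : ∀ t ∈ Set.Ici (0 : ℝ), ∀ e, HasDerivWithinAt (fun s => x s e)
      (x t e * (g e (|q (x t) e| / x t e) - 1)) (Set.Ici 0) t) :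
    ∃ f : Fin m → ℝ, IsBFS A b f ∧
      Tendsto x atTop (nhds (fun e => |f e|)) ∧
      Tendsto (fun t => fun e => |q (x t) e|) atTop (nhds (fun e => |f e|)) ∧
      Tendsto (fun t => energy c (x t) (q (x t))) atTop (nhds (∑ e, c e * |f e|)) ∧
      Tendsto (fun t => ∑ e, c e * x t e) atTop (nhds (∑ e, c e * |f e|)) := by
  classical
  have hc : ∀ e, 0 < c e := fun e => lt_of_lt_of_le one_pos (hc1 e)
  set u : ℝ → Fin m → ℝ := fun t e => |q (x t) e| / x t e with hu
  set V : ℝ → Fin m → ℝ := fun t e => c e * x t e * ((u t e ^ 2 - 1) * (g e (u t e) - 1)) with hV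
  set E : ℝ → ℝ := fun t => energy c (x t) (q (x t)) with hE
  set L : ℝ → ℝ := fun t => ∑ e, c e * x t e + E t with hL
  have hu0 : ∀ t ∈ Set.Ici (0 : ℝ), ∀ e, 0 ≤ u t e := fun t ht e =>
    div_nonneg (abs_nonneg _) (hpos t ht e).le
  have hprod : ∀ e, ∀ y ∈ Set.Ici (0 : ℝ), 0 ≤ (y ^ 2 - 1) * (g e y - 1) := by
    intro e y hy
    have hy' : (0 : ℝ) ≤ y := hy
    have h1 : (1 : ℝ) ∈ Set.Ici (0 : ℝ) := by simp
    rcases le_total y 1 with h | h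
    · have := (hgmono e).monotoneOn hy h1 h
      rw [hg1] at this
      apply mul_nonneg_of_nonpos_of_nonpos <;> nlinarith
    · have := (hgmono e).monotoneOn h1 hy h
      rw [hg1] at this
      apply mul_nonneg <;> nlinarith
  have hprod' : ∀ e, ∀ y ∈ Set.Ici (0 : ℝ), y ≠ 1 → 0 < (y ^ 2 - 1) * (g e y - 1) := by
    intro e y hy hne
    have hy' : (0 : ℝ) ≤ y := hy
    have h1 : (1 : ℝ) ∈ Set.Ici (0 : ℝ) := by simp
    rcases lt_or_gt_of_ne hne with h | h
    · have := hgmono e hy h1 h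
      rw [hg1] at this
      apply mul_pos_of_neg_of_neg <;> nlinarith
    · have := hgmono e h1 hy h
      rw [hg1] at this
      apply mul_pos <;> nlinarith
  have hV0 : ∀ t ∈ Set.Ici (0 : ℝ), ∀ e, 0 ≤ V t e := fun t ht e =>
    mul_nonneg (mul_nonneg (hc e).le (hpos t ht e).le) (hprod e _ (hu0 t ht e))
  have hLd : ∀ t ∈ Set.Ici (0 : ℝ), HasDerivWithinAt L (- ∑ e, V t e) (Set.Ici 0) t := by
    intro t ht
    have h1 := ph_energy_deriv hc q hq x (fun e => x t e * (g e (|q (x t) e| / x t e) - 1))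
      (Set.Ici 0) hpos t ht (hdyn t ht)
    have h2 : HasDerivWithinAt (fun r => ∑ e, c e * x r e)
      (∑ e, c e * (x t e * (g e (|q (x t) e| / x t e) - 1))) (Set.Ici 0) t :=
      HasDerivWithinAt.fun_sum fun e _ => (hdyn t ht e).const_mul _
    have h3 := h2.add h1
    refine h3.congr_deriv ?_
    rw [← Finset.sum_neg_distrib, ← Finset.sum_neg_distrib, ← Finset.sum_add_distrib]
    refine Finset.sum_congr rfl fun e _ => ?_
    simp only [hV, hu]
    rw [div_pow, div_pow, sq_abs]
    ring
  have hLc : ContinuousOn L (Set.Ici 0) := fun t ht => (hLd t ht).continuousWithinAt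
  have hLdi : ∀ t ∈ Set.Ioi (0 : ℝ), HasDerivAt L (- ∑ e, V t e) t := fun t ht =>
    (hLd t (Set.Ioi_subset_Ici_self ht)).hasDerivAt (Ici_mem_nhds ht)
  have hLanti : AntitoneOn L (Set.Ici 0) := by
    apply antitoneOn_of_deriv_nonpos (convex_Ici 0) hLc
    · intro t ht
      rw [interior_Ici] at ht
      exact (hLdi t ht).differentiableAt.differentiableWithinAt
    · intro t ht
      rw [interior_Ici] at ht
      rw [(hLdi t ht).deriv]
      have : 0 ≤ ∑ e, V t e := Finset.sum_nonneg fun e _ => hV0 t (Set.Ioi_subset_Ici_self ht) e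
      linarith
  have hE0 : ∀ t ∈ Set.Ici (0 : ℝ), 0 ≤ E t := fun t ht =>
    Finset.sum_nonneg fun e _ => mul_nonneg (div_nonneg (hc e).le (hpos t ht e).le) (sq_nonneg _)
  have hcx0 : ∀ t ∈ Set.Ici (0 : ℝ), 0 ≤ ∑ e, c e * x t e := fun t ht =>
    Finset.sum_nonneg fun e _ => mul_nonneg (hc e).le (hpos t ht e).le
  set C := L 0 with hC
  have hLC : ∀ t ∈ Set.Ici (0 : ℝ), L t ≤ C := fun t ht => hLanti (by simp) ht ht
  have hxC : ∀ t ∈ Set.Ici (0 : ℝ), ∀ e, x t e ≤ C := by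
    intro t ht e
    have h1 := Finset.single_le_sum (f := fun e => c e * x t e)
      (fun e _ => mul_nonneg (hc e).le (hpos t ht e).le) (Finset.mem_univ e)
    have h2 := hLC t ht
    have h3 := hE0 t ht
    have h4 := hpos t ht e
    have h5 := hc1 e
    simp only [hL] at h1 h2
    nlinarith
  have hEt : ∀ t ∈ Set.Ici (0 : ℝ), ∀ e, c e / x t e * (q (x t) e) ^ 2 ≤ C := by
    intro t ht e
    have h1 := Finset.single_le_sum (f := fun e => c e / x t e * (q (x t) e) ^ 2)
      (fun e _ => mul_nonneg (div_nonneg (hc e).le (hpos t ht e).le) (sq_nonneg _))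
      (Finset.mem_univ e)
    have h2 := hLC t ht
    have h3 := hcx0 t ht
    simp only [hL, hE, energy] at h1 h2
    linarith
  have hqC : ∀ t ∈ Set.Ici (0 : ℝ), ∀ e, (q (x t) e) ^ 2 ≤ C * x t e := by
    intro t ht e
    have h1 := hEt t ht e
    have h4 := hpos t ht e
    have h5 := hc1 e
    rw [div_mul_eq_mul_div, div_le_iff₀ h4] at h1
    nlinarith [sq_nonneg (q (x t) e)]
  have huC : ∀ t ∈ Set.Ici (0 : ℝ), ∀ e, x t e * u t e ^ 2 ≤ C := by
    intro t ht e
    have h4 := hpos t ht e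
    simp only [hu]
    rw [div_pow, sq_abs, ← mul_div_assoc, div_le_iff₀ (by positivity)]
    nlinarith [hqC t ht e]
  have huc : ∀ η > 0, ∃ τ > 0, ∀ s ∈ Set.Ici (0 : ℝ), ∀ t ∈ Set.Ici (0 : ℝ),
      |s - t| ≤ τ → ∀ e, |x s e - x t e| ≤ η := by
    intro η hη
    have h1 : ∀ e, ∃ τ > 0, ∀ s ∈ Set.Ici (0 : ℝ), ∀ t ∈ Set.Ici (0 : ℝ),
      |s - t| ≤ τ → |x s e - x t e| ≤ η := fun e =>
      ph_unifcont (z := fun t => x t e) (u := fun t => u t e) (g := g e) (M := C) (C := C)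
        (hg0 e) (hgmono e).monotoneOn (fun t ht => hpos t ht e) (fun t ht => hxC t ht e)
        (fun t ht => hu0 t ht e) (fun t ht => huC t ht e) (fun t ht => hdyn t ht e) η hη
    choose τ hτ hτ' using h1
    obtain ⟨τ₀, h2, h3⟩ : ∃ τ₀ > 0, ∀ e, τ₀ ≤ τ e := by
      rcases isEmpty_or_nonempty (Fin m) with hem | hne
      · exact ⟨1, one_pos, fun e => hem.elim e⟩
      · obtain ⟨e₀, he₀⟩ := Finite.exists_min τ
        exact ⟨τ e₀, hτ e₀, he₀⟩
    exact ⟨τ₀, h2, fun s hs t ht hst e => hτ' e s hs t ht (hst.trans (h3 e))⟩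
  obtain ⟨ℓ, hℓ⟩ : ∃ ℓ, Tendsto L atTop (nhds ℓ) := by
    have h1 : Antitone (fun t => L (max t 0)) := fun s t hst =>
      hLanti (by simp) (by simp) (max_le_max hst le_rfl)
    have h2 : BddBelow (Set.range (fun t => L (max t 0))) := by
      refine ⟨0, ?_⟩
      rintro _ ⟨t, rfl⟩
      have h0 : max t 0 ∈ Set.Ici (0 : ℝ) := by simp
      exact add_nonneg (hcx0 _ h0) (hE0 _ h0)
    refine ⟨_, (tendsto_atTop_ciInf h1 h2).congr' ?_⟩
    filter_upwards [eventually_ge_atTop 0] with t ht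
    rw [max_eq_left ht]
  -- the LaSalle argument
  have main : ∀ l : Ultrafilter ℝ, (l : Filter ℝ) ≤ atTop → ∃ f : Fin m → ℝ, IsBFS A b f ∧
      Tendsto x l (nhds (fun e => |f e|)) ∧ Tendsto (fun t => q (x t)) l (nhds f) ∧
      Tendsto E l (nhds (∑ e, c e * |f e|)) ∧ ℓ = 2 * costVec c f := by
    intro l hl
    have hlge : ∀ᶠ t in (l : Filter ℝ), t ∈ Set.Ici (0 : ℝ) := hl (eventually_ge_atTop 0)
    obtain ⟨x', hx'mem, hx'⟩ := (isCompact_Icc (a := fun _ : Fin m => (0 : ℝ))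
      (b := fun _ => C)).ultrafilter_le_nhds (l.map x) (by
        rw [Filter.le_principal_iff]
        have hmem : ∀ᶠ t in (l : Filter ℝ), x t ∈ Set.Icc (fun _ : Fin m => (0 : ℝ))
            (fun _ => C) := by
          filter_upwards [hlge] with t ht
          exact ⟨fun e => (hpos t ht e).le, fun e => hxC t ht e⟩
        exact hmem)
    have hxl : Tendsto x l (nhds x') := hx'
    have hx'0 : ∀ e, 0 ≤ x' e := fun e => hx'mem.1 e
    obtain ⟨f, hql, hopt, hEl⟩ := ph_limit q hq C l x (hlge.mono fun t ht => hpos t ht)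
      (hlge.mono fun t ht => hqC t ht) x' hxl
    -- convergence of q near x'
    set F : Filter ℝ := comap x (nhds x') ⊓ Filter.principal (Set.Ici 0) with hF
    have hqF : Tendsto (fun t => q (x t)) F (nhds f) := by
      rw [tendsto_iff_ultrafilter]
      intro k hk
      have hkge : ∀ᶠ t in (k : Filter ℝ), t ∈ Set.Ici (0 : ℝ) := by
        have : (k : Filter ℝ) ≤ Filter.principal (Set.Ici 0) := hk.trans inf_le_right
        exact this (mem_principal_self _)
      have hxk : Tendsto x k (nhds x') := tendsto_iff_comap.2 (hk.trans inf_le_left)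
      obtain ⟨f', hql', hopt', -⟩ := ph_limit q hq C k x (hkge.mono fun t ht => hpos t ht)
        (hkge.mono fun t ht => hqC t ht) x' hxk
      rw [ph_opt_unique hc hx'0 hopt hopt']
      exact hql'
    have hxF : Tendsto x F (nhds x') := tendsto_iff_comap.2 inf_le_left
    have hFge : ∀ᶠ t in F, t ∈ Set.Ici (0 : ℝ) := by
      have : F ≤ Filter.principal (Set.Ici 0) := inf_le_right
      exact this (mem_principal_self _)
    have hfix : ∀ e, |f e| = x' e := by
      intro e
      by_cases he : x' e = 0
      · rw [hopt.2.1 e he, he, abs_zero]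
      by_contra hne
      have hxpos : 0 < x' e := lt_of_le_of_ne (hx'0 e) (Ne.symm he)
      set y := |f e| / x' e with hy
      have hy0 : 0 ≤ y := div_nonneg (abs_nonneg _) hxpos.le
      have hy1 : y ≠ 1 := by
        intro h1
        rw [hy, div_eq_one_iff_eq he] at h1
        exact hne h1
      have hxe : Tendsto (fun t => x t e) F (nhds (x' e)) := tendsto_pi_nhds.1 hxF e
      have hqe : Tendsto (fun t => q (x t) e) F (nhds (f e)) := tendsto_pi_nhds.1 hqF e
      have hue : Tendsto (fun t => u t e) F (nhds y) := hqe.abs.div hxe he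
      have hge : Tendsto (fun t => g e (u t e)) F (nhds (g e y)) := by
        have h1 : ContinuousWithinAt (g e) (Set.Ici 0) y := (hgdiff e).continuousOn y hy0
        refine h1.tendsto.comp (tendsto_nhdsWithin_iff.2 ⟨hue, ?_⟩)
        filter_upwards [hFge] with t ht using hu0 t ht e
      have hVe : Tendsto (fun t => V t e) F
          (nhds (c e * x' e * ((y ^ 2 - 1) * (g e y - 1)))) :=
        (hxe.const_mul (c e)).mul (((hue.pow 2).sub_const 1).mul (hge.sub_const 1))
      have hVpos : 0 < c e * x' e * ((y ^ 2 - 1) * (g e y - 1)) :=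
        mul_pos (mul_pos (hc e) hxpos) (hprod' e y hy0 hy1)
      set ε := c e * x' e * ((y ^ 2 - 1) * (g e y - 1)) / 2 with hε
      have hε0 : 0 < ε := by positivity
      have hev : ∀ᶠ t in F, ε < V t e := hVe.eventually (lt_mem_nhds (by rw [hε]; linarith))
      rw [hF, eventually_inf_principal, eventually_comap] at hev
      obtain ⟨r, hr, hball⟩ := Metric.eventually_nhds_iff.1 hev
      obtain ⟨τ, hτ, hτ'⟩ := huc (r / 3) (by positivity)
      have hdiff : Tendsto (fun t => L t - L (t + τ)) l (nhds (ℓ - ℓ)) := by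
        have h1 : Tendsto (fun t => L (t + τ)) atTop (nhds ℓ) :=
          hℓ.comp (tendsto_atTop_add_const_right _ τ tendsto_id)
        exact (hℓ.sub h1).mono_left hl
      rw [sub_self] at hdiff
      have hev2 : ∀ᶠ t in (l : Filter ℝ), L t - L (t + τ) < ε * τ :=
        hdiff.eventually (gt_mem_nhds (by positivity))
      have hev3 : ∀ᶠ t in (l : Filter ℝ), dist (x t) x' < r / 3 :=
        hxl (Metric.ball_mem_nhds x' (by positivity))
      obtain ⟨t, ht2, ht3, ht0⟩ := (hev2.and (hev3.and hlge)).exists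
      have ht0' : (0 : ℝ) ≤ t := ht0
      have hin : ∀ s ∈ Set.Icc t (t + τ), ε < V s e := by
        intro s hs
        have hs0 : s ∈ Set.Ici (0 : ℝ) := le_trans ht0' hs.1
        refine hball (y := x s) ?_ s rfl hs0
        have h1 : dist (x s) (x t) ≤ r / 3 := by
          rw [dist_pi_le_iff (by positivity)]
          intro e'
          rw [Real.dist_eq]
          apply hτ' s hs0 t ht0
          rw [abs_le]; constructor <;> linarith [hs.1, hs.2]
        have := dist_triangle (x s) (x t) x'
        linarith
      have hmv := (convex_Icc t (t + τ)).image_sub_le_mul_sub_of_deriv_le (f := L) (C := -ε)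
        (hLc.mono fun s hs => le_trans ht0' hs.1)
        (by
          intro s hs
          rw [interior_Icc] at hs
          exact (hLdi s (lt_of_le_of_lt ht0' hs.1)).differentiableAt.differentiableWithinAt)
        (by
          intro s hs
          rw [interior_Icc] at hs
          have hs0 : 0 < s := lt_of_le_of_lt ht0' hs.1
          rw [(hLdi s hs0).deriv]
          have h1 := hin s ⟨hs.1.le, hs.2.le⟩
          have h2 := Finset.single_le_sum (f := fun e => V s e)
            (fun e _ => hV0 s hs0.le e) (Finset.mem_univ e)
          linarith)
        t ⟨le_rfl, by linarith⟩ (t + τ) ⟨by linarith, le_rfl⟩ (by linarith)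
      nlinarith
    have hx'f : x' = fun e => |f e| := funext fun e => (hfix e).symm
    have hen : energy c x' f = ∑ e, c e * |f e| := by
      unfold energy
      refine Finset.sum_congr rfl fun e _ => ?_
      rw [← hfix e]
      by_cases h0 : f e = 0
      · simp [h0]
      · have : |f e| ≠ 0 := abs_ne_zero.2 h0
        rw [← sq_abs (f e)]
        field_simp
    rw [hen] at hEl
    refine ⟨f, ?_, hx'f ▸ hxl, hql, hEl, ?_⟩
    · refine ph_bfs_of_tight hc hrank hdistinct (fun e => f e / |f e|) _ f rfl hopt.1 ?_ ?_
      · intro e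
        by_cases h0 : f e = 0
        · simp [h0]
        · have : |f e| ≠ 0 := abs_ne_zero.2 h0
          rw [div_mul_eq_mul_div, ← sq, ← sq_abs]
          field_simp
      · intro h hA hh
        rw [← hopt.2.2 h hA (fun e he => hh e (hopt.2.1 e he))]
        refine Finset.sum_congr rfl fun e _ => ?_
        rw [← hfix e]
        ring
    · have h1 : Tendsto L l (nhds (∑ e, c e * x' e + ∑ e, c e * |f e|)) :=
        (tendsto_finsetSum _ fun e _ => (tendsto_pi_nhds.1 hxl e).const_mul (c e)).add hEl
      have h2 := tendsto_nhds_unique (hℓ.mono_left hl) h1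
      rw [h2, hx'f]
      unfold costVec
      ring
  obtain ⟨f, hf, -, -, -, hfℓ⟩ := main (Ultrafilter.of atTop) (Ultrafilter.of_le atTop)
  have main2 : ∀ l : Ultrafilter ℝ, (l : Filter ℝ) ≤ atTop →
      Tendsto x l (nhds (fun e => |f e|)) ∧ Tendsto (fun t => q (x t)) l (nhds f) ∧
      Tendsto E l (nhds (∑ e, c e * |f e|)) := by
    intro l hl
    obtain ⟨f', hf', h1, h2, h3, h4⟩ := main l hl
    have : f = f' := by
      by_contra hne
      exact hdistinct f f' hf hf' hne (by linarith)
    rw [this]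
    exact ⟨h1, h2, h3⟩
  have hxT : Tendsto x atTop (nhds (fun e => |f e|)) :=
    (tendsto_iff_ultrafilter _ _ _).2 fun l hl => (main2 l hl).1
  have hqT : Tendsto (fun t => q (x t)) atTop (nhds f) :=
    (tendsto_iff_ultrafilter _ _ _).2 fun l hl => (main2 l hl).2.1
  have hET : Tendsto E atTop (nhds (∑ e, c e * |f e|)) :=
    (tendsto_iff_ultrafilter _ _ _).2 fun l hl => (main2 l hl).2.2
  refine ⟨f, hf, hxT, ?_, hET, ?_⟩
  · rw [tendsto_pi_nhds]
    intro e
    exact (tendsto_pi_nhds.1 hqT e).abs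
  · exact tendsto_finsetSum _ fun e _ => (tendsto_pi_nhds.1 hxT e).const_mul (c e)
end
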